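/- arXiv:math/0506576 — 2 statements merged into one kernel-verified Lean document; each statement's English description precedes it below -/
import Mathlib

section
/- There exists Y > 0 such that for every τ in the upper half-plane ℍ with Im τ > Y, setting s(τ) = −27·η(3τ)¹²/η(τ)¹², one has (3E₂(3τ) − E₂(τ))/2 = (1 − s(τ))^{2/3} · ₂F₁(1/3, 1/3; 1; s(τ))², where the power is the principal branch. -/
open Complex

/-- Gauss hypergeometric series `₂F₁(a,b;c;z)`. -/
noncomputable def hyp2F1 (a b c z : ℂ) : ℂ :=
  ∑' n : ℕ, ((ascPochhammer ℂ n).eval a * (ascPochhammer ℂ n).eval b) /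
    ((ascPochhammer ℂ n).eval c * (n.factorial : ℂ)) * z ^ n

/-- `q = e^{2πiτ}`. -/
noncomputable def qpar (τ : ℂ) : ℂ := Complex.exp (2 * (Real.pi : ℂ) * Complex.I * τ)

/-- Normalized Eisenstein series of weight 2: `E₂(τ) = 1 − 24 ∑_{n≥1} n qⁿ/(1−qⁿ)`. -/
noncomputable def Eis2 (τ : ℂ) : ℂ :=
  1 - 24 * ∑' n : ℕ, ((n : ℂ) + 1) * qpar τ ^ (n + 1) / (1 - qpar τ ^ (n + 1))

/-- Dedekind eta function `η(τ) = q^{1/24} ∏_{n≥1} (1 − qⁿ)`, `q^{1/24} = e^{2πiτ/24}`. -/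
noncomputable def dedekindEta (τ : ℂ) : ℂ :=
  Complex.exp (2 * (Real.pi : ℂ) * Complex.I * τ / 24) * ∏' n : ℕ, (1 - qpar τ ^ (n + 1))

section PowerSeries

/-- A power series with polynomially bounded coefficients converges in the unit disc. -/
lemma summable_mul_pow_of_polyBound {c : ℕ → ℂ} {C : ℝ} {k : ℕ}
    (hc : ∀ n, ‖c n‖ ≤ C * ((n : ℝ) + 1) ^ k) {z : ℂ} (hz : ‖z‖ < 1) :
    Summable fun n => c n * z ^ n := by
  have hs : Summable fun n : ℕ => C * (((n : ℝ) + 1) ^ k * ‖z‖ ^ n) := by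
    refine Summable.mul_left _ ?_
    rcases eq_or_ne ‖z‖ 0 with h0 | h0
    · rw [h0]
      exact summable_of_ne_finset_zero (s := {0}) fun n hn => by
        rw [zero_pow (by simpa using hn), mul_zero]
    · have := (summable_nat_add_iff 1).2
        (summable_pow_mul_geometric_of_norm_lt_one (R := ℝ) k (r := ‖z‖) (by simpa using hz))
      refine (this.mul_right ‖z‖⁻¹).congr fun n => ?_
      push_cast
      field_simp
      ring
  refine Summable.of_norm_bounded hs fun n => ?_
  rw [norm_mul, norm_pow, ← mul_assoc]
  gcongr
  exact hc n

lemma polyBound_derivCoeff {c : ℕ → ℂ} {C : ℝ} {k : ℕ}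
    (hc : ∀ n, ‖c n‖ ≤ C * ((n : ℝ) + 1) ^ k) (n : ℕ) :
    ‖((n : ℂ) + 1) * c (n + 1)‖ ≤ (C * 2 ^ k) * ((n : ℝ) + 1) ^ (k + 1) := by
  have hC : 0 ≤ C := by simpa using (norm_nonneg _).trans (hc 0)
  have h1 : ‖(n : ℂ) + 1‖ = (n : ℝ) + 1 := by
    rw [← Nat.cast_succ, Complex.norm_natCast, Nat.cast_succ]
  rw [norm_mul, h1]
  calc ((n : ℝ) + 1) * ‖c (n + 1)‖ ≤ ((n : ℝ) + 1) * (C * (2 * ((n : ℝ) + 1)) ^ k) := by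
        refine mul_le_mul_of_nonneg_left ((hc (n + 1)).trans ?_) (by positivity)
        gcongr
        push_cast
        linarith [(Nat.cast_nonneg n : (0 : ℝ) ≤ n)]
    _ = _ := by rw [mul_pow]; ring

lemma hasDerivAt_tsum_mul_pow {c : ℕ → ℂ} {C : ℝ} {k : ℕ}
    (hc : ∀ n, ‖c n‖ ≤ C * ((n : ℝ) + 1) ^ k) {z : ℂ} (hz : ‖z‖ < 1) :
    HasDerivAt (fun w => ∑' n, c n * w ^ n) (∑' n : ℕ, ((n : ℂ) + 1) * c (n + 1) * z ^ n) z := by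
  obtain ⟨r, hzr, hr⟩ := exists_between hz
  have hr0 : 0 ≤ r := (norm_nonneg z).trans hzr.le
  have hu : Summable fun n : ℕ => ‖(n : ℂ) * c n * (r : ℂ) ^ (n - 1)‖ := by
    refine (summable_nat_add_iff 1).1 ?_
    have := (summable_mul_pow_of_polyBound (polyBound_derivCoeff hc) (z := (r : ℂ))
      (by simpa [abs_of_nonneg hr0] using hr)).norm
    simpa using this
  have key := hasDerivAt_tsum_of_isPreconnected (g := fun n w => c n * w ^ n)
    (g' := fun n w => (n : ℂ) * c n * w ^ (n - 1)) hu Metric.isOpen_ball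
    (convex_ball (0 : ℂ) r).isPreconnected
    (fun n y _ => by
      convert! (hasDerivAt_pow n y).const_mul (c n) using 1
      ring)
    (fun n y hy => by
      rw [norm_mul, norm_mul _ ((r : ℂ) ^ _), norm_pow, norm_pow, Complex.norm_real,
        Real.norm_of_nonneg hr0]
      gcongr
      exact (by simpa using hy : ‖y‖ < r).le)
    (y₀ := z) (by simpa using hzr) (summable_mul_pow_of_polyBound hc hz) (by simpa using hzr)
  convert! key using 1
  rw [Summable.tsum_eq_zero_add (f := fun n : ℕ => (n : ℂ) * c n * z ^ (n - 1))
    (Summable.of_norm_bounded hu fun n => ?_)]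
  · simp
  · rw [norm_mul, norm_mul _ ((r : ℂ) ^ _), norm_pow, norm_pow, Complex.norm_real,
      Real.norm_of_nonneg hr0]
    gcongr

/-- The hypergeometric equation for `₂F₁(1/3,1/3;1;z)` in the unit disc. -/
lemma hyp2F1_third_ode : ∃ F₁ F₂ : ℂ → ℂ, ∀ z : ℂ, ‖z‖ < 1 →
    HasDerivAt (hyp2F1 (1 / 3) (1 / 3) 1) (F₁ z) z ∧ HasDerivAt F₁ (F₂ z) z ∧
    z * (1 - z) * F₂ z + (1 - 5 / 3 * z) * F₁ z = hyp2F1 (1 / 3) (1 / 3) 1 z / 9 := by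
  set c : ℕ → ℂ := fun n => ((ascPochhammer ℂ n).eval (1 / 3) * (ascPochhammer ℂ n).eval (1 / 3)) /
    ((ascPochhammer ℂ n).eval 1 * (n.factorial : ℂ)) with hcdef
  have hrec : ∀ n : ℕ, ((n : ℂ) + 1) ^ 2 * c (n + 1) = ((n : ℂ) + 1 / 3) ^ 2 * c n := by
    intro n
    have h1 : (n.factorial : ℂ) ≠ 0 := by exact_mod_cast n.factorial_ne_zero
    have h2 : (n : ℂ) + 1 ≠ 0 := Nat.cast_add_one_ne_zero n
    simp only [hcdef, ascPochhammer_eval_one, ascPochhammer_succ_eval, Nat.factorial_succ]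
    push_cast
    field_simp
    ring
  have hc : ∀ n, ‖c n‖ ≤ 1 * ((n : ℝ) + 1) ^ 0 := by
    intro n
    rw [pow_zero, mul_one]
    induction n with
    | zero => simp [hcdef]
    | succ n ih =>
      have h := congrArg norm (hrec n)
      rw [norm_mul, norm_mul, norm_pow, norm_pow] at h
      have h1 : ‖(n : ℂ) + 1‖ = (n : ℝ) + 1 := by
        rw [← Nat.cast_succ, Complex.norm_natCast, Nat.cast_succ]
      have h2 : ‖(n : ℂ) + 1 / 3‖ ≤ (n : ℝ) + 1 := by
        refine (norm_add_le _ _).trans ?_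
        rw [Complex.norm_natCast]
        norm_num
      rw [h1] at h
      have h3 : ((n : ℝ) + 1) ^ 2 * ‖c (n + 1)‖ ≤ ((n : ℝ) + 1) ^ 2 * 1 := by
        rw [h]
        gcongr
      exact le_of_mul_le_mul_left h3 (by positivity)
  have hc1 := polyBound_derivCoeff hc
  have hc2 := polyBound_derivCoeff hc1
  refine ⟨fun z => ∑' n : ℕ, ((n : ℂ) + 1) * c (n + 1) * z ^ n,
    fun z => ∑' n : ℕ, ((n : ℂ) + 1) * (((n + 1 : ℕ) + 1 : ℂ) * c (n + 1 + 1)) * z ^ n,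
    fun z hz => ⟨hasDerivAt_tsum_mul_pow hc hz, hasDerivAt_tsum_mul_pow hc1 hz, ?_⟩⟩
  have s0 := (summable_mul_pow_of_polyBound hc hz).hasSum
  have s1 := (summable_mul_pow_of_polyBound hc1 hz).hasSum
  have s2 := (summable_mul_pow_of_polyBound hc2 hz).hasSum
  change _ = (∑' n, c n * z ^ n) / 9
  set A := ∑' n, c n * z ^ n
  set B := ∑' n : ℕ, ((n : ℂ) + 1) * c (n + 1) * z ^ n
  set D := ∑' n : ℕ, ((n : ℂ) + 1) * (((n + 1 : ℕ) + 1 : ℂ) * c (n + 1 + 1)) * z ^ n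
  have t1 : HasSum (fun n : ℕ => (n : ℂ) * c n * z ^ n) (z * B) := by
    rw [← hasSum_nat_add_iff' 1]
    simp only [Finset.range_one, Finset.sum_singleton, Nat.cast_zero, zero_mul, sub_zero]
    convert! s1.mul_left z using 2 with n
    push_cast
    ring
  have t2 : HasSum (fun n : ℕ => (n : ℂ) * ((n : ℂ) + 1) * c (n + 1) * z ^ n) (z * D) := by
    rw [← hasSum_nat_add_iff' 1]
    simp only [Finset.range_one, Finset.sum_singleton, Nat.cast_zero, zero_mul, sub_zero]
    convert! s2.mul_left z using 2 with n
    push_cast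
    ring
  have t3 : HasSum (fun n : ℕ => (n : ℂ) * ((n : ℂ) - 1) * c n * z ^ n) (z * (z * D)) := by
    rw [← hasSum_nat_add_iff' 1]
    simp only [Finset.range_one, Finset.sum_singleton, Nat.cast_zero, zero_mul, sub_zero]
    convert! t2.mul_left z using 2 with n
    push_cast
    ring
  have hL := t2.add s1
  have hR := (t3.add (t1.mul_left (5 / 3))).add (s0.mul_left (1 / 9))
  have heq := hL.unique (hR.congr_fun ?_)
  · linear_combination heq
  · intro n
    linear_combination z ^ n * hrec n
end PowerSeries

section CubicTransformation

/-- Uniqueness for the solution regular at the origin of a second order equation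
`d/dz (K · df/dz) = R · f` with a simple zero of `K` at the origin. -/
lemma regular_solution_unique {r : ℝ} {f g f₁ g₁ f₂ g₂ K K₁ R : ℂ → ℂ}
    (hf : ∀ z ∈ Metric.ball (0 : ℂ) r, HasDerivAt f (f₁ z) z)
    (hf₁ : ∀ z ∈ Metric.ball (0 : ℂ) r, HasDerivAt f₁ (f₂ z) z)
    (hg : ∀ z ∈ Metric.ball (0 : ℂ) r, HasDerivAt g (g₁ z) z)
    (hg₁ : ∀ z ∈ Metric.ball (0 : ℂ) r, HasDerivAt g₁ (g₂ z) z)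
    (hK : ∀ z, HasDerivAt K (K₁ z) z)
    (hK0 : K 0 = 0) (hK1 : K₁ 0 ≠ 0) (hKne : ∀ z ∈ Metric.ball (0 : ℂ) r, z ≠ 0 → K z ≠ 0)
    (hfe : ∀ z ∈ Metric.ball (0 : ℂ) r, K z * f₂ z + K₁ z * f₁ z = R z * f z)
    (hge : ∀ z ∈ Metric.ball (0 : ℂ) r, K z * g₂ z + K₁ z * g₁ z = R z * g z)
    (hgne : ∀ z ∈ Metric.ball (0 : ℂ) r, g z ≠ 0) (h0 : f 0 = g 0) :
    ∀ z ∈ Metric.ball (0 : ℂ) r, f z = g z := by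
  intro z hz
  have hr : 0 < r := (norm_nonneg z).trans_lt (by simpa using hz)
  have h0m : (0 : ℂ) ∈ Metric.ball (0 : ℂ) r := by simpa using hr
  have const : ∀ u v : ℂ → ℂ, (∀ w ∈ Metric.ball (0 : ℂ) r, HasDerivAt u (v w) w) →
      (∀ w ∈ Metric.ball (0 : ℂ) r, v w = 0) →
      ∀ w ∈ Metric.ball (0 : ℂ) r, u w = u 0 := by
    intro u v hu hv w hw
    refine Metric.isOpen_ball.is_const_of_deriv_eq_zero (convex_ball (0 : ℂ) r).isPreconnected
      (fun x hx => (hu x hx).differentiableAt.differentiableWithinAt)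
      (fun x hx => by rw [(hu x hx).deriv, hv x hx]; rfl) hw h0m
  have hW := const (fun w => K w * (f₁ w * g w - g₁ w * f w)) _
    (fun w hw => (hK w).mul (((hf₁ w hw).mul (hg w hw)).sub ((hg₁ w hw).mul (hf w hw))))
    (fun w hw => by
      linear_combination g w * hfe w hw - f w * hge w hw)
  have hw0 : ∀ w ∈ Metric.ball (0 : ℂ) r, f₁ w * g w - g₁ w * f w = 0 := by
    intro w hw
    rcases eq_or_ne w 0 with rfl | hne
    · have h1 := hfe 0 hw
      have h2 := hge 0 hw
      rw [hK0] at h1 h2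
      refine (mul_eq_zero.1 ?_).resolve_left hK1
      linear_combination g 0 * h1 - f 0 * h2
    · have := hW w hw
      simp only [hK0, zero_mul] at this
      exact (mul_eq_zero.1 this).resolve_left (hKne w hw hne)
  have hquot := const (fun w => f w / g w) _ (fun w hw => (hf w hw).div (hg w hw) (hgne w hw))
    (fun w hw => by
      rw [div_eq_zero_iff]
      left
      linear_combination hw0 w hw) z hz
  simp only [h0, div_self (hgne 0 h0m)] at hquot
  exact (div_eq_one_iff_eq (hgne z hz)).1 hquot

lemma hyp2F1_zero (a b c : ℂ) : hyp2F1 a b c 0 = 1 := by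
  unfold hyp2F1
  rw [tsum_eq_single 0 fun n hn => by simp [hn]]
  simp

/-- A cubic transformation of `₂F₁(1/3,1/3;1;·)` near the origin. -/
lemma hyp2F1_cubic : ∃ r : ℝ, 0 < r ∧ ∀ h : ℂ, ‖h‖ < r →
    hyp2F1 (1 / 3) (1 / 3) 1 (-27 * (h * (1 + 9 * h + 27 * h ^ 2))) =
      hyp2F1 (1 / 3) (1 / 3) 1 (-27 * h ^ 3 / (1 + 9 * h + 27 * h ^ 2)) *
        (1 + 9 * h + 27 * h ^ 2) ^ (-(1 / 3) : ℂ) := by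
  obtain ⟨F₁, F₂, hF⟩ := hyp2F1_third_ode
  have hF0 := hyp2F1_zero (1 / 3) (1 / 3) 1
  set F := hyp2F1 (1 / 3) (1 / 3) 1
  set Q : ℂ → ℂ := fun h => 1 + 9 * h + 27 * h ^ 2 with hQ
  have hQc : Continuous Q := by fun_prop
  have hFc : ContinuousAt F 0 := (hF 0 (by simp)).1.continuousAt
  have ev : ∀ᶠ h in nhds (0 : ℂ), ‖-27 * (h * Q h)‖ < 1 ∧ ‖-27 * h ^ 3 / Q h‖ < 1 ∧
      Q h ∈ Complex.slitPlane ∧ F (-27 * h ^ 3 / Q h) ≠ 0 := by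
    have hQ0 : Q 0 = 1 := by simp [hQ]
    have hc2 : ContinuousAt (fun h => -27 * h ^ 3 / Q h) 0 :=
      ContinuousAt.div (by fun_prop) hQc.continuousAt (by simp [hQ0])
    refine Filter.Eventually.and ?_ (Filter.Eventually.and ?_ (Filter.Eventually.and ?_ ?_))
    · have : ContinuousAt (fun h => ‖-27 * (h * Q h)‖) 0 := by fun_prop
      exact this.eventually_lt_const (by simp)
    · exact hc2.norm.eventually_lt_const (by simp)
    · exact hQc.continuousAt.eventually_mem
        (Complex.isOpen_slitPlane.mem_nhds (by simp [hQ0]))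
    · have : ContinuousAt (fun h => F (-27 * h ^ 3 / Q h)) 0 :=
        ContinuousAt.comp (g := F) (f := fun h => -27 * h ^ 3 / Q h) (by simpa using hFc) hc2
      exact this.eventually_ne (by simp [hF0])
  obtain ⟨r, hr, hball⟩ := Metric.eventually_nhds_iff_ball.1 ev
  refine ⟨r, hr, fun h hh => ?_⟩
  have hQd : ∀ z, HasDerivAt Q (9 + 54 * z) z := fun z => by
    convert! (((hasDerivAt_id z).const_mul 9).const_add 1).add
      (((hasDerivAt_id z).pow 2).const_mul 27) using 1
    simp
    ring
  have hQne : ∀ z ∈ Metric.ball (0 : ℂ) r, Q z ≠ 0 := fun z hz =>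
    Complex.slitPlane_ne_zero (hball z hz).2.2.1
  have hgd : ∀ z ∈ Metric.ball (0 : ℂ) r, HasDerivAt (fun z => Q z ^ (-(1 / 3) : ℂ))
      (-(1 / 3) * (9 + 54 * z) / Q z * Q z ^ (-(1 / 3) : ℂ)) z := fun z hz => by
    convert! (hQd z).cpow_const (c := -(1 / 3)) (hball z hz).2.2.1 using 1
    rw [Complex.cpow_sub _ _ (hQne z hz), Complex.cpow_one]
    ring
  have hs : ∀ z, HasDerivAt (fun z => -27 * (z * Q z)) (-27 * (1 + 9 * z) ^ 2) z := fun z => by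
    convert! ((hasDerivAt_id z).mul (hQd z)).const_mul (-27) using 1
    simp [hQ]
    ring
  have ht : ∀ z ∈ Metric.ball (0 : ℂ) r, HasDerivAt (fun z => -27 * z ^ 3 / Q z)
      (-81 * z ^ 2 * (1 + 3 * z) ^ 2 / Q z ^ 2) z := fun z hz => by
    convert! (((hasDerivAt_id z).pow 3).const_mul (-27)).div (hQd z) (hQne z hz) using 1
    simp [hQ]
    ring
  have hα : ∀ z ∈ Metric.ball (0 : ℂ) r, HasDerivAt (fun z => -81 * z ^ 2 * (1 + 3 * z) ^ 2 / Q z ^ 2)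
      (-162 * z * (1 + 3 * z) * ((1 + 6 * z) * Q z - z * (1 + 3 * z) * (9 + 54 * z)) / Q z ^ 3) z :=
    fun z hz => by
    convert! ((((hasDerivAt_id z).pow 2).const_mul (-81)).mul
      ((((hasDerivAt_id z).const_mul 3).const_add 1).pow 2)).div ((hQd z).pow 2)
      (pow_ne_zero 2 (hQne z hz)) using 1
    have := hQne z hz
    simp
    field_simp
    ring
  have hβ : ∀ z ∈ Metric.ball (0 : ℂ) r, HasDerivAt (fun z => -(3 + 18 * z) / Q z)
      ((-18 * Q z + (3 + 18 * z) * (9 + 54 * z)) / Q z ^ 2) z :=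
    fun z hz => by
    convert! (((hasDerivAt_id z).const_mul 18).const_add 3).neg.div (hQd z) (hQne z hz) using 1
    simp
    ring
  have main := regular_solution_unique (r := r)
    (f := fun z => F (-27 * (z * Q z)))
    (f₁ := fun z => F₁ (-27 * (z * Q z)) * (-27 * (1 + 9 * z) ^ 2))
    (f₂ := fun z => F₂ (-27 * (z * Q z)) * (-27 * (1 + 9 * z) ^ 2) * (-27 * (1 + 9 * z) ^ 2)
      + F₁ (-27 * (z * Q z)) * (-486 * (1 + 9 * z)))
    (g := fun z => F (-27 * z ^ 3 / Q z) * Q z ^ (-(1 / 3) : ℂ))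
    (g₁ := fun z => (F₁ (-27 * z ^ 3 / Q z) * (-81 * z ^ 2 * (1 + 3 * z) ^ 2 / Q z ^ 2)
      + F (-27 * z ^ 3 / Q z) * (-(3 + 18 * z) / Q z)) * Q z ^ (-(1 / 3) : ℂ))
    (g₂ := fun z => ((F₂ (-27 * z ^ 3 / Q z) * (-81 * z ^ 2 * (1 + 3 * z) ^ 2 / Q z ^ 2) *
          (-81 * z ^ 2 * (1 + 3 * z) ^ 2 / Q z ^ 2)
      + F₁ (-27 * z ^ 3 / Q z) * (-162 * z * (1 + 3 * z) *
          ((1 + 6 * z) * Q z - z * (1 + 3 * z) * (9 + 54 * z)) / Q z ^ 3))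
      + (F₁ (-27 * z ^ 3 / Q z) * (-81 * z ^ 2 * (1 + 3 * z) ^ 2 / Q z ^ 2) *
          (-(3 + 18 * z) / Q z)
      + F (-27 * z ^ 3 / Q z) * ((-18 * Q z + (3 + 18 * z) * (9 + 54 * z)) / Q z ^ 2)))
          * Q z ^ (-(1 / 3) : ℂ)
      + (F₁ (-27 * z ^ 3 / Q z) * (-81 * z ^ 2 * (1 + 3 * z) ^ 2 / Q z ^ 2)
      + F (-27 * z ^ 3 / Q z) * (-(3 + 18 * z) / Q z)) *
        (-(1 / 3) * (9 + 54 * z) / Q z * Q z ^ (-(1 / 3) : ℂ)))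
    (K := fun z => z * Q z) (K₁ := fun z => (1 + 9 * z) ^ 2)
    (R := fun z => -3 * (1 + 9 * z))
    ?_ ?_ ?_ ?_ ?_ ?_ ?_ ?_ ?_ ?_ ?_ ?_ h (by simpa using hh)
  · exact main
  · exact fun z hz => HasDerivAt.comp (h₂ := F) z (hF _ (hball z hz).1).1 (hs z)
  · intro z hz
    have h2 : HasDerivAt (fun z : ℂ => -27 * (1 + 9 * z) ^ 2) (-486 * (1 + 9 * z)) z := by
      convert! ((((hasDerivAt_id z).const_mul 9).const_add 1).pow 2).const_mul (-27) using 1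
      simp
      ring
    exact (HasDerivAt.comp (h₂ := F₁) z (hF _ (hball z hz).1).2.1 (hs z)).mul h2
  · intro z hz
    have h1 := (HasDerivAt.comp (h₂ := F) z (hF _ (hball z hz).2.1).1 (ht z hz)).mul (hgd z hz)
    convert! h1 using 1
    simp only [Function.comp_apply]
    ring
  · intro z hz
    exact (((HasDerivAt.comp (h₂ := F₁) z (hF _ (hball z hz).2.1).2.1 (ht z hz)).mul (hα z hz)).add
      ((HasDerivAt.comp (h₂ := F) z (hF _ (hball z hz).2.1).1 (ht z hz)).mul (hβ z hz))).mul (hgd z hz)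
  · intro z
    convert! (hasDerivAt_id z).mul (hQd z) using 1
    simp [hQ]
    ring
  · simp
  · simp
  · exact fun z hz hne => mul_ne_zero hne (hQne z hz)
  · intro z hz
    have ode := (hF _ (hball z hz).1).2.2
    simp only [hQ] at ode ⊢
    linear_combination (-27 * (1 + 9 * z)) * ode
  · intro z hz
    have ode := (hF _ (hball z hz).2.1).2.2
    have hne := hQne z hz
    generalize hG : Q z ^ (-(1 / 3) : ℂ) = G
    generalize F (-27 * z ^ 3 / Q z) = a at *
    generalize F₁ (-27 * z ^ 3 / Q z) = b at *
    generalize F₂ (-27 * z ^ 3 / Q z) = d at *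
    have ode' : -27 * z ^ 3 * (1 + 3 * z) ^ 3 * d + (Q z + 45 * z ^ 3) * Q z * b = a * Q z ^ 2 / 9 := by
      have : (1 + 3 * z) ^ 3 = Q z + 27 * z ^ 3 := by simp only [hQ]; ring
      rw [this]
      field_simp at ode
      linear_combination ode / 27
    have hq : Q z = 1 + 9 * z + 27 * z ^ 2 := rfl
    generalize Q z = q at *
    field_simp
    rw [hq] at ode' ⊢
    linear_combination (-729 * G * z ^ 2 * (1 + 3 * z)) * ode'
  · exact fun z hz => mul_ne_zero (hball z hz).2.2.2
      (by rw [Complex.cpow_ne_zero_iff]; exact Or.inl (hQne z hz))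
  · simp [hQ, hF0]

end CubicTransformation

section JacobiCube

open Finset Filter Topology

/-- Euler's product `∏_{n ≥ 1} (1 - qⁿ)`. -/
noncomputable def eulerProd (q : ℂ) : ℂ := ∏' n : ℕ, (1 - q ^ (n + 1))

/-- The finite product `∏_{k=1}^n (1 - q^k)`. -/
noncomputable def qPoch (q : ℂ) (n : ℕ) : ℂ := ∏ k ∈ range n, (1 - q ^ (k + 1))

/-- Gaussian binomial coefficients. -/
noncomputable def gaussBinom (q : ℂ) : ℕ → ℕ → ℂ
  | _, 0 => 1
  | 0, _ + 1 => 0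
  | n + 1, k + 1 => gaussBinom q n k + q ^ (k + 1) * gaussBinom q n (k + 1)

/-- The triangular number `n(n-1)/2`. -/
def triangle (n : ℕ) : ℕ := ∑ i ∈ range n, i

lemma triangle_succ (n : ℕ) : triangle (n + 1) = triangle n + n := sum_range_succ _ _

lemma qPoch_succ (q : ℂ) (n : ℕ) : qPoch q (n + 1) = qPoch q n * (1 - q ^ (n + 1)) :=
  prod_range_succ _ _

lemma gaussBinom_eq_zero_of_lt (q : ℂ) : ∀ {n k : ℕ}, n < k → gaussBinom q n k = 0
  | 0, k + 1, _ => by simp [gaussBinom]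
  | n + 1, k + 1, h => by
    rw [gaussBinom, gaussBinom_eq_zero_of_lt q (by omega), gaussBinom_eq_zero_of_lt q (by omega)]
    simp

lemma gaussBinom_self (q : ℂ) (n : ℕ) : gaussBinom q n n = 1 := by
  induction n with
  | zero => simp [gaussBinom]
  | succ n ih => simp [gaussBinom, ih, gaussBinom_eq_zero_of_lt]

lemma gaussBinom_mul_qPoch (q : ℂ) (a b : ℕ) :
    gaussBinom q (a + b) a * (qPoch q a * qPoch q b) = qPoch q (a + b) := by
  obtain ⟨n, hn⟩ : ∃ n, n = a + b := ⟨_, rfl⟩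
  induction n generalizing a b with
  | zero =>
    obtain ⟨rfl, rfl⟩ : a = 0 ∧ b = 0 := by omega
    simp [gaussBinom, qPoch]
  | succ n ih =>
    rcases a with _ | a
    · simp [gaussBinom, qPoch]
    rcases b with _ | b
    · simp [gaussBinom_self, qPoch]
    have h1 := ih a (b + 1) (by omega)
    have h2 := ih (a + 1) b (by omega)
    rw [show a + 1 + (b + 1) = (a + (b + 1)) + 1 by ring, gaussBinom, qPoch_succ q (a + (b + 1))]
    rw [show a + 1 + b = a + (b + 1) by ring] at h2
    rw [qPoch_succ q a] at h2 ⊢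
    rw [qPoch_succ q b] at h1 ⊢
    linear_combination (1 - q ^ (a + 1)) * h1 + q ^ (a + 1) * (1 - q ^ (b + 1)) * h2

/-- The `q`-binomial theorem. -/
lemma prod_one_sub_mul_pow (q x : ℂ) (n : ℕ) :
    ∏ k ∈ range n, (1 - x * q ^ k) =
      ∑ k ∈ range (n + 1), (-1) ^ k * gaussBinom q n k * q ^ triangle k * x ^ k := by
  induction n generalizing x with
  | zero => simp [gaussBinom, triangle]
  | succ n ih =>
    have h : ∏ k ∈ range n, (1 - x * q ^ (k + 1)) = ∏ k ∈ range n, (1 - x * q * q ^ k) :=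
      prod_congr rfl fun k _ => by ring
    rw [prod_range_succ', h, ih (x * q), sum_range_succ' _ (n + 1), mul_sub,
      mul_comm _ (x * q ^ 0)]
    have h0 : ∑ k ∈ range (n + 1), (-1) ^ k * gaussBinom q n k * q ^ triangle k * (x * q) ^ k =
        ∑ k ∈ range (n + 1), (-1) ^ (k + 1) * gaussBinom q n (k + 1) * q ^ triangle (k + 1) *
          (x * q) ^ (k + 1) + 1 := by
      rw [sum_range_succ', sum_range_succ _ n, gaussBinom_eq_zero_of_lt q (Nat.lt_succ_self n)]
      simp [gaussBinom, triangle]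
    nth_rewrite 1 [h0]
    rw [mul_sum, mul_one, add_sub_right_comm, ← sum_sub_distrib]
    congr 1
    · refine sum_congr rfl fun k _ => ?_
      rw [gaussBinom, triangle_succ]
      ring
    · simp [gaussBinom, triangle]

lemma triangle_add_triangle_sub (m j : ℕ) :
    triangle m + triangle (m + j + 1) = (m + j) * m + triangle (j + 1) := by
  induction m with
  | zero => simp [triangle]
  | succ m ih =>
    rw [triangle_succ m, show m + 1 + j + 1 = (m + j + 1) + 1 by ring, triangle_succ (m + j + 1)]
    linarith

lemma triangle_add_triangle_add (n j : ℕ) :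
    triangle (n + 1 + j) + triangle (n + 1) = n * (n + 1 + j) + triangle (j + 1) := by
  induction j with
  | zero =>
    have := sum_range_id_mul_two (n + 1)
    simp only [triangle, add_tsub_cancel_right] at this ⊢
    simp
    linarith
  | succ j ih =>
    rw [← add_assoc, triangle_succ (n + 1 + j), triangle_succ (j + 1)]
    linarith

lemma norm_pow_succ_lt_one {q : ℂ} (hq : ‖q‖ < 1) (n : ℕ) : ‖q ^ (n + 1)‖ < 1 := by
  rw [norm_pow]
  exact pow_lt_one₀ (norm_nonneg q) hq n.succ_ne_zero

lemma one_sub_pow_succ_ne_zero {q : ℂ} (hq : ‖q‖ < 1) (n : ℕ) : 1 - q ^ (n + 1) ≠ 0 := fun h => by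
  have h1 : ‖q ^ (n + 1)‖ = 1 := by rw [← sub_eq_zero.1 h, norm_one]
  exact (norm_pow_succ_lt_one hq n).ne h1

lemma qPoch_ne_zero {q : ℂ} (hq : ‖q‖ < 1) (n : ℕ) : qPoch q n ≠ 0 :=
  prod_ne_zero_iff.2 fun k _ => one_sub_pow_succ_ne_zero hq k

/-- A finite form of Jacobi's identity for the cube of Euler's product. -/
lemma qPoch_sq {q : ℂ} (hq0 : q ≠ 0) (hq : ‖q‖ < 1) (n : ℕ) :
    qPoch q n ^ 2 = ∑ j ∈ range (n + 1), (-1) ^ j * (2 * (j : ℂ) + 1) *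
      (qPoch q (2 * n + 1) / (qPoch q (n - j) * qPoch q (n + 1 + j))) * q ^ triangle (j + 1) := by
  set x : ℂ := (q ^ n)⁻¹ with hx
  have hxq : x * q ^ n = 1 := inv_mul_cancel₀ (pow_ne_zero n hq0)
  set A : ℂ → ℂ := fun y => ∏ k ∈ range n, (1 - y * q ^ k) with hA
  set B : ℂ → ℂ := fun y => ∏ k ∈ range n, (1 - y * q ^ (n + 1 + k)) with hB
  have hAd : DifferentiableAt ℂ A x := by fun_prop
  have hBd : DifferentiableAt ℂ B x := by fun_prop
  have hfac : ∀ y, ∏ k ∈ range (2 * n + 1), (1 - y * q ^ k) = A y * (1 - y * q ^ n) * B y := by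
    intro y
    rw [show 2 * n + 1 = n + 1 + n by ring, prod_range_add, prod_range_succ]
  have hd1 : HasDerivAt (fun y => ∏ k ∈ range (2 * n + 1), (1 - y * q ^ k))
      (-(A x * q ^ n * B x)) x := by
    simp_rw [hfac]
    convert! (hAd.hasDerivAt.mul (((hasDerivAt_id x).mul_const (q ^ n)).const_sub 1)).mul
      hBd.hasDerivAt using 1
    simp [hxq]
  have hd2 : HasDerivAt (fun y => ∏ k ∈ range (2 * n + 1), (1 - y * q ^ k))
      (∑ k ∈ range (2 * n + 1 + 1), (-1) ^ k * gaussBinom q (2 * n + 1) k * q ^ triangle k *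
        (k * x ^ (k - 1))) x := by
    simp_rw [prod_one_sub_mul_pow]
    exact HasDerivAt.fun_sum fun k _ => (hasDerivAt_pow k x).const_mul _
  have heq := hd1.unique hd2
  have hBx : B x = qPoch q n := prod_congr rfl fun k _ => by
    linear_combination (-q ^ (k + 1)) * hxq
  have hAx : A x * q ^ triangle (n + 1) = (-1) ^ n * qPoch q n := by
    rw [triangle, sum_range_succ', add_zero, ← prod_pow_eq_pow_sum, ← prod_range_reflect, hA]
    simp only
    rw [← prod_mul_distrib, qPoch, ← prod_range_reflect (fun k => 1 - q ^ (k + 1)), ← card_range n,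
      ← prod_const, card_range, ← prod_mul_distrib]
    refine prod_congr rfl fun k hk => ?_
    have hk' := mem_range.1 hk
    have h2 : q ^ n = q ^ (n - 1 - k + 1) * q ^ k := by
      rw [← pow_add]
      congr 1
      omega
    rw [h2] at hxq
    linear_combination (-1 : ℂ) * hxq
  have hsum : (-(-1) ^ n) * qPoch q n ^ 2 = ∑ k ∈ range (2 * n + 1 + 1),
      (-1) ^ k * gaussBinom q (2 * n + 1) k * (k : ℂ) *
        (q ^ (triangle k + triangle (n + 1)) * x ^ k) := by
    have h1 : (-(-1) ^ n) * qPoch q n ^ 2 =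
        -(A x * q ^ n * B x) * (x * q ^ triangle (n + 1)) := by
      linear_combination (x * q ^ n * B x) * hAx + ((-1) ^ n * qPoch q n * B x) * hxq
        + (-1) ^ n * qPoch q n * hBx
    rw [h1, heq, sum_mul]
    refine sum_congr rfl fun k _ => ?_
    rcases k with _ | k
    · simp
    · rw [pow_add, pow_succ x k, Nat.add_sub_cancel]
      ring
  have hpow : ∀ k t : ℕ, triangle k + triangle (n + 1) = n * k + t →
      q ^ (triangle k + triangle (n + 1)) * x ^ k = q ^ t := by
    intro k t h
    have : (x * q ^ n) ^ k = 1 := by rw [hxq, one_pow]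
    rw [h, pow_add, pow_mul]
    rw [mul_pow] at this
    linear_combination q ^ t * this
  rw [show 2 * n + 1 + 1 = (n + 1) + (n + 1) by ring, sum_range_add,
    ← sum_range_reflect _ (n + 1), ← sum_add_distrib] at hsum
  have hsgn : (-(-1 : ℂ) ^ n) * (-(-1) ^ n) = 1 := by
    rw [neg_mul_neg, ← mul_pow]
    simp
  have hn2 : qPoch q n ^ 2 = (-(-1) ^ n) * ((-(-1) ^ n) * qPoch q n ^ 2) := by
    rw [← mul_assoc, hsgn, one_mul]
  rw [hn2, hsum, mul_sum]
  refine sum_congr rfl fun j hj => ?_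
  obtain ⟨m, rfl⟩ : ∃ m, n = m + j := ⟨n - j, by have := mem_range.1 hj; omega⟩
  have e1 : m + j + 1 - 1 - j = m := by omega
  have e2 : m + j - j = m := by omega
  have g1 := gaussBinom_mul_qPoch q m (m + j + 1 + j)
  have g2 := gaussBinom_mul_qPoch q (m + j + 1 + j) m
  rw [show m + (m + j + 1 + j) = 2 * (m + j) + 1 by ring] at g1
  rw [show m + j + 1 + j + m = 2 * (m + j) + 1 by ring, mul_comm (qPoch q _)] at g2
  have hne : qPoch q m * qPoch q (m + j + 1 + j) ≠ 0 :=
    mul_ne_zero (qPoch_ne_zero hq _) (qPoch_ne_zero hq _)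
  rw [e1, e2, eq_div_of_mul_eq hne g1, eq_div_of_mul_eq hne g2,
    hpow m _ (triangle_add_triangle_sub m j), hpow _ _ (triangle_add_triangle_add (m + j) j)]
  have hj2 : ((-1 : ℂ) ^ j) * (-1) ^ j = 1 := by rw [← mul_pow]; simp
  have hm2 : ((-1 : ℂ) ^ m) * (-1) ^ m = 1 := by rw [← mul_pow]; simp
  have hs1 : (-1 : ℂ) ^ (m + j + 1 + j) = -((-1) ^ m * ((-1) ^ j * (-1) ^ j)) := by ring
  rw [hs1, hj2, pow_add (-1 : ℂ) m j]
  push_cast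
  generalize qPoch q (2 * (m + j) + 1) / (qPoch q m * qPoch q (m + j + 1 + j)) = G
  linear_combination ((-1) ^ j * (2 * (j : ℂ) + 1) * G * q ^ triangle (j + 1)) * hm2

lemma tendsto_qPoch {q : ℂ} (hq : ‖q‖ < 1) :
    Tendsto (qPoch q) atTop (𝓝 (eulerProd q)) :=
  (ModularForm.multipliable_one_sub_pow hq).hasProd.tendsto_prod_nat

lemma eulerProd_ne_zero {q : ℂ} (hq : ‖q‖ < 1) : eulerProd q ≠ 0 := by
  have hs : Summable fun n : ℕ => ‖-q ^ (n + 1)‖ := by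
    simp_rw [norm_neg, norm_pow, pow_succ]
    exact (summable_geometric_of_lt_one (norm_nonneg q) hq).mul_right _
  have h := tprod_one_add_ne_zero_of_summable (f := fun n : ℕ => -q ^ (n + 1))
    (fun n => by simpa only [← sub_eq_add_neg] using one_sub_pow_succ_ne_zero hq n) hs
  simp only [← sub_eq_add_neg] at h
  exact h

/-- The series in Jacobi's identity for the cube of Euler's product. -/
noncomputable def jacobiSeries (q : ℂ) : ℂ :=
  ∑' j : ℕ, (-1) ^ j * (2 * (j : ℂ) + 1) * q ^ triangle (j + 1)

lemma le_triangle_succ (j : ℕ) : j ≤ triangle (j + 1) := by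
  rw [triangle_succ]
  omega

lemma norm_odd (j : ℕ) : ‖2 * (j : ℂ) + 1‖ = 2 * (j : ℝ) + 1 := by
  exact_mod_cast Complex.norm_natCast (2 * j + 1)

lemma summable_odd_mul_pow (C : ℝ) {q : ℂ} (hq : ‖q‖ < 1) :
    Summable fun j : ℕ => C * (2 * (j : ℝ) + 1) * ‖q‖ ^ j := by
  have h := summable_mul_pow_of_polyBound (c := fun j => 2 * (j : ℂ) + 1) (C := 2) (k := 1)
    (fun j => by rw [norm_odd]; linarith) hq
  refine (h.norm.mul_left C).congr fun j => ?_
  rw [norm_mul, norm_odd, norm_pow, mul_assoc]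

/-- Jacobi's identity. -/
lemma eulerProd_cube {q : ℂ} (hq : ‖q‖ < 1) : eulerProd q ^ 3 = jacobiSeries q := by
  rcases eq_or_ne q 0 with rfl | hq0
  · have h1 : eulerProd 0 = 1 := by simp [eulerProd]
    have h2 : jacobiSeries 0 = 1 := by
      rw [jacobiSeries, tsum_eq_single 0]
      · simp [triangle]
      · intro j hj
        have := le_triangle_succ j
        rw [zero_pow (by omega), mul_zero]
    rw [h1, h2, one_pow]
  have hE := eulerProd_ne_zero hq
  have ht := tendsto_qPoch hq
  obtain ⟨M, hM⟩ := ht.norm.bddAbove_range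
  obtain ⟨N, hN⟩ := (ht.inv₀ hE).norm.bddAbove_range
  have hM' : ∀ n, ‖qPoch q n‖ ≤ M := fun n => hM ⟨n, rfl⟩
  have hN' : ∀ n, ‖qPoch q n‖⁻¹ ≤ N := fun n => by
    rw [← norm_inv]
    exact hN ⟨n, rfl⟩
  have hM0 : 0 ≤ M := (norm_nonneg _).trans (hM' 0)
  have hN0 : 0 ≤ N := (inv_nonneg.2 (norm_nonneg _)).trans (hN' 0)
  let f : ℕ → ℕ → ℂ := fun n j => if j ≤ n then (-1) ^ j * (2 * (j : ℂ) + 1) *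
      (qPoch q (2 * n + 1) / (qPoch q (n - j) * qPoch q (n + 1 + j))) * q ^ triangle (j + 1) else 0
  have hf : ∀ n, ∑' j, f n j = qPoch q n ^ 2 := by
    intro n
    rw [qPoch_sq hq0 hq, tsum_eq_sum (s := range (n + 1)) fun j hj => if_neg (by simpa using hj)]
    exact sum_congr rfl fun j hj => if_pos (Nat.lt_succ_iff.1 (mem_range.1 hj))
  have hlim := tendsto_tsum_of_dominated_convergence (𝓕 := atTop) (f := f)
    (g := fun j => (-1) ^ j * (2 * (j : ℂ) + 1) *
      (eulerProd q / (eulerProd q * eulerProd q)) * q ^ triangle (j + 1))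
    (bound := fun j => (M * (N * N)) * (2 * (j : ℝ) + 1) * ‖q‖ ^ j)
    (summable_odd_mul_pow _ hq) (fun j => by
      have h1 : Tendsto (fun n => (-1) ^ j * (2 * (j : ℂ) + 1) *
          (qPoch q (2 * n + 1) / (qPoch q (n - j) * qPoch q (n + 1 + j))) * q ^ triangle (j + 1))
          atTop (𝓝 ((-1) ^ j * (2 * (j : ℂ) + 1) *
            (eulerProd q / (eulerProd q * eulerProd q)) * q ^ triangle (j + 1))) := by
        refine Tendsto.mul_const _ (Tendsto.const_mul _ (Tendsto.div ?_ (Tendsto.mul ?_ ?_)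
          (mul_ne_zero hE hE)))
        · exact ht.comp (tendsto_atTop_mono (fun n => by simp only [id]; omega) tendsto_id)
        · exact ht.comp (tendsto_sub_atTop_nat j)
        · exact ht.comp (tendsto_atTop_mono (fun n => by simp only [id]; omega) tendsto_id)
      refine h1.congr' ?_
      filter_upwards [eventually_ge_atTop j] with n hn
      exact (if_pos hn).symm)
    (Eventually.of_forall fun n j => by
      by_cases hj : j ≤ n
      · simp only [f, if_pos hj, norm_mul, norm_inv, norm_pow, norm_neg, norm_one, one_pow, one_mul,
          norm_odd, div_eq_mul_inv, mul_inv]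
        rw [mul_comm (2 * (j : ℝ) + 1)]
        gcongr ?_ * _ * ?_
        · exact mul_le_mul (hM' _) (mul_le_mul (hN' _) (hN' _) (by positivity) hN0)
            (by positivity) hM0
        · exact pow_le_pow_of_le_one (norm_nonneg q) hq.le (le_triangle_succ j)
      · simp only [f, if_neg hj, norm_zero]
        positivity)
  simp_rw [hf] at hlim
  have h := tendsto_nhds_unique (ht.pow 2) hlim
  have h3 : ∑' j : ℕ, (-1) ^ j * (2 * (j : ℂ) + 1) *
      (eulerProd q / (eulerProd q * eulerProd q)) * q ^ triangle (j + 1) =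
      (eulerProd q)⁻¹ * jacobiSeries q := by
    rw [jacobiSeries, ← tsum_mul_left]
    refine tsum_congr fun j => ?_
    field_simp
  rw [h3] at h
  rw [pow_succ, h]
  field_simp

lemma norm_mul_lt_one_of_pow_eq_one {q w : ℂ} (hq : ‖q‖ < 1) {n : ℕ} (hn : n ≠ 0)
    (hw : w ^ n = 1) : ‖w * q‖ < 1 := by
  rwa [norm_mul, Complex.norm_eq_one_of_pow_eq_one hw hn, one_mul]

lemma summable_jacobiSeries {q : ℂ} (hq : ‖q‖ < 1) :
    Summable fun j : ℕ => (-1) ^ j * (2 * (j : ℂ) + 1) * q ^ triangle (j + 1) := by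
  refine Summable.of_norm_bounded (summable_odd_mul_pow 1 hq) fun j => ?_
  simp only [norm_mul, norm_pow, norm_neg, norm_one, one_pow, one_mul, norm_odd]
  gcongr _ * ?_
  exact pow_le_pow_of_le_one (norm_nonneg q) hq.le (le_triangle_succ j)

lemma triangle_mod_three (m : ℕ) : triangle (3 * m + 2) = 9 * triangle (m + 1) + 1 ∧
    3 ∣ triangle (3 * m + 1) ∧ 3 ∣ triangle (3 * m + 3) := by
  have h : triangle (3 * m + 2) = 9 * triangle (m + 1) + 1 := by
    induction m with
    | zero => simp [triangle, sum_range_succ]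
    | succ m ih =>
      rw [show 3 * (m + 1) + 2 = 3 * m + 2 + 1 + 1 + 1 by ring, triangle_succ, triangle_succ,
        triangle_succ, ih, triangle_succ (m + 1)]
      ring
  have h1 : triangle (3 * m + 2) = triangle (3 * m + 1) + (3 * m + 1) := triangle_succ _
  have h2 : triangle (3 * m + 3) = triangle (3 * m + 2) + (3 * m + 2) := triangle_succ _
  refine ⟨h, ?_, ?_⟩ <;> omega

lemma jacobiSeries_sub_mul {q w : ℂ} (hq : ‖q‖ < 1) (hw : w ^ 3 = 1) :
    jacobiSeries q - jacobiSeries (w * q) = -3 * (1 - w) * q * jacobiSeries (q ^ 9) := by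
  have hwq := norm_mul_lt_one_of_pow_eq_one hq three_ne_zero hw
  have hinj : Function.Injective fun m : ℕ => 3 * m + 1 := fun a b h => by
    simpa using h
  rw [jacobiSeries, jacobiSeries, ← (summable_jacobiSeries hq).tsum_sub (summable_jacobiSeries hwq),
    ← hinj.tsum_eq, jacobiSeries, ← tsum_mul_left]
  · refine tsum_congr fun m => ?_
    rw [show 3 * m + 1 + 1 = 3 * m + 2 by ring, (triangle_mod_three m).1, mul_pow w,
      pow_succ w, show 9 * triangle (m + 1) = 3 * (3 * triangle (m + 1)) by ring, pow_mul w, hw,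
      one_pow, show (-1 : ℂ) ^ (3 * m + 1) = -(-1) ^ m by
        rw [pow_succ, pow_mul]; norm_num]
    push_cast
    ring
  · intro j hj
    by_contra hj'
    refine hj ?_
    have h3 : 3 ∣ triangle (j + 1) := by
      obtain ⟨m, rfl | rfl | rfl⟩ : ∃ m, j = 3 * m ∨ j = 3 * m + 1 ∨ j = 3 * m + 2 :=
        ⟨j / 3, by omega⟩
      · exact (triangle_mod_three m).2.1
      · exact absurd ⟨m, rfl⟩ hj'
      · exact (triangle_mod_three m).2.2
    obtain ⟨t, ht⟩ := h3
    simp only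
    rw [ht, mul_pow w, pow_mul w, hw, one_pow, one_mul, sub_self]

lemma qPoch_mul_three {w : ℂ} (hw : w ^ 2 + w + 1 = 0) (q : ℂ) (N : ℕ) :
    qPoch q (3 * N) * qPoch (w * q) (3 * N) * qPoch (w ^ 2 * q) (3 * N) * qPoch (q ^ 9) N =
      qPoch (q ^ 3) (3 * N) * qPoch (q ^ 3) N ^ 3 := by
  have hw3 : w ^ 3 = 1 := by linear_combination (w - 1) * hw
  induction N with
  | zero => simp [qPoch]
  | succ N ih =>
    have e : ∀ x : ℂ, qPoch x (3 * (N + 1)) = qPoch x (3 * N) *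
        ((1 - x ^ (3 * N + 1)) * (1 - x ^ (3 * N + 2)) * (1 - x ^ (3 * N + 3))) := fun x => by
      rw [show 3 * (N + 1) = 3 * N + 1 + 1 + 1 by ring, qPoch_succ, qPoch_succ, qPoch_succ]
      ring
    have hwN : w ^ (3 * N) = 1 := by rw [pow_mul, hw3, one_pow]
    have hwN2 : (w ^ 2) ^ (3 * N) = 1 := by rw [← pow_mul, mul_comm, pow_mul, hwN, one_pow]
    have e1 : (1 - q ^ (3 * N + 1)) * (1 - (w * q) ^ (3 * N + 1)) *
        (1 - (w ^ 2 * q) ^ (3 * N + 1)) = 1 - (q ^ 3) ^ (3 * N + 1) := by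
      rw [mul_pow, mul_pow, pow_succ w, pow_succ (w ^ 2), hwN, hwN2, pow_right_comm q 3]
      generalize q ^ (3 * N + 1) = y
      linear_combination (-y + y ^ 2 * w - (w - 1) * y ^ 3) * hw
    have e2 : (1 - q ^ (3 * N + 2)) * (1 - (w * q) ^ (3 * N + 2)) *
        (1 - (w ^ 2 * q) ^ (3 * N + 2)) = 1 - (q ^ 3) ^ (3 * N + 2) := by
      rw [mul_pow, mul_pow, pow_add w, pow_add (w ^ 2), hwN, hwN2, pow_right_comm q 3]
      generalize q ^ (3 * N + 2) = y
      have hw4 : w ^ 4 = w := by linear_combination w * hw3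
      have hw6 : w ^ 6 = 1 := by linear_combination (w ^ 3 + 1) * hw3
      linear_combination (-y + y ^ 2) * hw + (y ^ 2 - y) * hw4 + (y ^ 2 - y ^ 3) * hw6
    have e3 : (1 - q ^ (3 * N + 3)) * (1 - (w * q) ^ (3 * N + 3)) *
        (1 - (w ^ 2 * q) ^ (3 * N + 3)) = (1 - (q ^ 3) ^ (N + 1)) ^ 3 := by
      have h1 : w ^ (3 * N + 3) = 1 := by rw [pow_add, hwN, hw3, one_mul]
      have h2 : (w ^ 2) ^ (3 * N + 3) = 1 := by rw [← pow_mul, mul_comm, pow_mul, h1, one_pow]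
      rw [mul_pow, mul_pow, h1, h2, ← pow_mul q 3]
      ring
    rw [e q, e (w * q), e (w ^ 2 * q), e (q ^ 3), qPoch_succ, qPoch_succ, ← e1, ← e2]
    have e4 : (1 - (q ^ 3) ^ (3 * N + 3)) = 1 - (q ^ 9) ^ (N + 1) := by
      rw [← pow_mul, ← pow_mul]
      ring
    rw [e4, mul_pow (qPoch (q ^ 3) N), ← e3]
    generalize 1 - q ^ (3 * N + 1) = x₁, 1 - q ^ (3 * N + 2) = x₂, 1 - q ^ (3 * N + 3) = x₃,
      1 - (w * q) ^ (3 * N + 1) = y₁, 1 - (w * q) ^ (3 * N + 2) = y₂,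
      1 - (w * q) ^ (3 * N + 3) = y₃, 1 - (w ^ 2 * q) ^ (3 * N + 1) = z₁,
      1 - (w ^ 2 * q) ^ (3 * N + 2) = z₂, 1 - (w ^ 2 * q) ^ (3 * N + 3) = z₃,
      1 - (q ^ 9) ^ (N + 1) = t
    linear_combination (x₁ * x₂ * x₃ * y₁ * y₂ * y₃ * z₁ * z₂ * z₃ * t) * ih

lemma exists_sq_add_self_add_one : ∃ w : ℂ, w ^ 2 + w + 1 = 0 := by
  obtain ⟨w, hw⟩ := IsAlgClosed.exists_eq_mul_self (-3 : ℂ)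
  exact ⟨(w - 1) / 2, by linear_combination (-1 / 4 : ℂ) * hw⟩

/-- The cubic relation between `E(q)`, `E(q³)` and `E(q⁹)`, with `E` Euler's product. -/
lemma eulerProd_cubic {q : ℂ} (hq : ‖q‖ < 1) :
    eulerProd (q ^ 3) ^ 12 = eulerProd q ^ 9 * eulerProd (q ^ 9) ^ 3 +
      9 * q * eulerProd q ^ 6 * eulerProd (q ^ 9) ^ 6 +
      27 * q ^ 2 * eulerProd q ^ 3 * eulerProd (q ^ 9) ^ 9 := by
  obtain ⟨w, hw⟩ := exists_sq_add_self_add_one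
  have hw3 : w ^ 3 = 1 := by linear_combination (w - 1) * hw
  have hw6 : (w ^ 2) ^ 3 = 1 := by linear_combination (w ^ 3 + 1) * hw3
  have h1 := norm_mul_lt_one_of_pow_eq_one hq three_ne_zero hw3
  have h2 := norm_mul_lt_one_of_pow_eq_one hq three_ne_zero hw6
  have h3 := norm_pow_succ_lt_one hq 2
  have h9 := norm_pow_succ_lt_one hq 8
  have hN : Tendsto (fun N : ℕ => 3 * N) atTop atTop :=
    tendsto_atTop_mono (fun n => by simp only [id]; omega) tendsto_id
  have hprod : eulerProd q * eulerProd (w * q) * eulerProd (w ^ 2 * q) * eulerProd (q ^ 9) =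
      eulerProd (q ^ 3) * eulerProd (q ^ 3) ^ 3 := by
    refine tendsto_nhds_unique (f := fun N => qPoch q (3 * N) * qPoch (w * q) (3 * N) *
      qPoch (w ^ 2 * q) (3 * N) * qPoch (q ^ 9) N) (l := atTop)
      (((((tendsto_qPoch hq).comp hN).mul ((tendsto_qPoch h1).comp hN)).mul
        ((tendsto_qPoch h2).comp hN)).mul (tendsto_qPoch h9)) ?_
    simp_rw [qPoch_mul_three hw]
    exact ((tendsto_qPoch h3).comp hN).mul ((tendsto_qPoch h3).pow 3)
  have j1 := jacobiSeries_sub_mul hq hw3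
  have j2 := jacobiSeries_sub_mul hq hw6
  rw [← eulerProd_cube hq, ← eulerProd_cube h9, ← eulerProd_cube h1] at j1
  rw [← eulerProd_cube hq, ← eulerProd_cube h9, ← eulerProd_cube h2] at j2
  have k1 : eulerProd (w * q) ^ 3 =
      eulerProd q ^ 3 + 3 * (1 - w) * q * eulerProd (q ^ 9) ^ 3 := by
    linear_combination -j1
  have k2 : eulerProd (w ^ 2 * q) ^ 3 =
      eulerProd q ^ 3 + 3 * (1 - w ^ 2) * q * eulerProd (q ^ 9) ^ 3 := by
    linear_combination -j2
  have h12 : eulerProd (q ^ 3) ^ 12 = eulerProd q ^ 3 * eulerProd (w * q) ^ 3 *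
      eulerProd (w ^ 2 * q) ^ 3 * eulerProd (q ^ 9) ^ 3 := by
    rw [← mul_pow, ← mul_pow, ← mul_pow, hprod]
    ring
  rw [h12, k1, k2]
  linear_combination (3 * q * eulerProd q ^ 3 * eulerProd (q ^ 9) ^ 6 *
    (3 * (w - 2) * q * eulerProd (q ^ 9) ^ 3 - eulerProd q ^ 3)) * hw

/-- The Lambert series `∑_{n ≥ 1} n qⁿ / (1 - qⁿ)`. -/
noncomputable def lambertSeries (q : ℂ) : ℂ :=
  ∑' n : ℕ, ((n : ℂ) + 1) * q ^ (n + 1) / (1 - q ^ (n + 1))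

lemma differentiableOn_eulerProd : DifferentiableOn ℂ eulerProd (Metric.ball 0 1) :=
  ModularForm.differentiableOn_tprod_one_sub_pow

lemma mul_deriv_eulerProd {q : ℂ} (hq : ‖q‖ < 1) :
    q * deriv eulerProd q = -lambertSeries q * eulerProd q := by
  rcases eq_or_ne q 0 with rfl | hq0
  · simp [lambertSeries]
  have hterm : ∀ n : ℕ, logDeriv (fun x : ℂ => 1 - x ^ (n + 1)) q =
      -q⁻¹ * (((n : ℂ) + 1) * q ^ (n + 1) / (1 - q ^ (n + 1))) := fun n => by
    have h : HasDerivAt (fun x : ℂ => 1 - x ^ (n + 1)) (-(((n + 1 : ℕ) : ℂ) * q ^ n)) q := by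
      simpa using (hasDerivAt_pow (n + 1) q).const_sub 1
    rw [logDeriv_apply, h.deriv]
    push_cast
    rw [pow_succ]
    field_simp
  have hsum : Summable fun n : ℕ => ((n : ℂ) + 1) * q ^ (n + 1) / (1 - q ^ (n + 1)) := by
    have h := summable_norm_pow_mul_geometric_div_one_sub 1 hq
    have h1 := (summable_nat_add_iff (f := fun n : ℕ => (n : ℂ) ^ 1 * q ^ n / (1 - q ^ n)) 1).2 h
    refine h1.congr fun n => ?_
    simp only [pow_one, Nat.cast_add, Nat.cast_one]
  have hmem : q ∈ Metric.ball (0 : ℂ) 1 := by simpa using hq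
  have hd : ∀ n : ℕ, DifferentiableOn ℂ (fun x : ℂ => 1 - x ^ (n + 1)) (Metric.ball 0 1) :=
    fun n => by fun_prop
  have hlog : Summable fun n : ℕ => logDeriv (fun x : ℂ => 1 - x ^ (n + 1)) q := by
    simp_rw [hterm]
    exact hsum.mul_left _
  have key := logDeriv_tprod_eq_tsum Metric.isOpen_ball hmem
    (one_sub_pow_succ_ne_zero hq) hd hlog
    ModularForm.multipliableLocallyUniformlyOn_one_sub_pow (eulerProd_ne_zero hq)
  simp_rw [hterm, tsum_mul_left] at key
  rw [logDeriv_apply] at key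
  have h2 : deriv eulerProd q / eulerProd q = -q⁻¹ * lambertSeries q := key
  rw [(div_eq_iff (eulerProd_ne_zero hq)).1 h2]
  field_simp

lemma hasDerivAt_eulerProd_pow {q : ℂ} (hq : ‖q‖ < 1) (k : ℕ) : ∃ d : ℂ,
    HasDerivAt (fun x => eulerProd (x ^ (k + 1))) d q ∧
      q * d = -((k : ℂ) + 1) * lambertSeries (q ^ (k + 1)) * eulerProd (q ^ (k + 1)) := by
  have hk := norm_pow_succ_lt_one hq k
  have h1 : HasDerivAt eulerProd (deriv eulerProd (q ^ (k + 1))) (q ^ (k + 1)) :=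
    (differentiableOn_eulerProd.differentiableAt
      (Metric.isOpen_ball.mem_nhds (by simpa using hk))).hasDerivAt
  refine ⟨_, HasDerivAt.comp (h₂ := eulerProd) q h1 (hasDerivAt_pow (k + 1) q), ?_⟩
  have h2 := mul_deriv_eulerProd hk
  rw [add_tsub_cancel_right]
  push_cast
  linear_combination ((k : ℂ) + 1) * h2

/-- The `q`-expansion of `(3 E₂(3τ) - E₂(τ)) / 2`. -/
noncomputable def cubicTheta (q : ℂ) : ℂ := 1 - 36 * lambertSeries (q ^ 3) + 12 * lambertSeries q

/-- The cubic eta quotient `η(9τ)³ / η(τ)³`. -/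
noncomputable def etaQuot (q : ℂ) : ℂ := q * eulerProd (q ^ 9) ^ 3 / eulerProd q ^ 3

/-- The `q`-expansion of `-27 η(3τ)¹² / η(τ)¹²`. -/
noncomputable def hauptmodul (q : ℂ) : ℂ := -27 * (q * eulerProd (q ^ 3) ^ 12 / eulerProd q ^ 12)

lemma eulerProd_cube_pow_etaQuot {q : ℂ} (hq : ‖q‖ < 1) :
    eulerProd (q ^ 3) ^ 12 = eulerProd q ^ 9 * eulerProd (q ^ 9) ^ 3 *
      (1 + 9 * etaQuot q + 27 * etaQuot q ^ 2) := by
  rw [eulerProd_cubic hq, etaQuot]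
  have := eulerProd_ne_zero hq
  field_simp

lemma one_add_etaQuot_ne_zero {q : ℂ} (hq : ‖q‖ < 1) :
    1 + 9 * etaQuot q + 27 * etaQuot q ^ 2 ≠ 0 := by
  intro h
  have := eulerProd_cube_pow_etaQuot hq
  rw [h, mul_zero] at this
  exact pow_ne_zero 12 (eulerProd_ne_zero (norm_pow_succ_lt_one hq 2)) this

lemma hauptmodul_eq {q : ℂ} (hq : ‖q‖ < 1) : hauptmodul q =
    -27 * (etaQuot q * (1 + 9 * etaQuot q + 27 * etaQuot q ^ 2)) := by
  have h := eulerProd_cube_pow_etaQuot hq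
  have h0 := eulerProd_ne_zero hq
  rw [hauptmodul, h]
  generalize 1 + 9 * etaQuot q + 27 * etaQuot q ^ 2 = Q
  rw [etaQuot]
  field_simp

lemma hauptmodul_pow_three {q : ℂ} (hq : ‖q‖ < 1) : hauptmodul (q ^ 3) =
    -27 * etaQuot q ^ 3 / (1 + 9 * etaQuot q + 27 * etaQuot q ^ 2) := by
  have h := eulerProd_cube_pow_etaQuot hq
  have hQ := one_add_etaQuot_ne_zero hq
  have h0 := eulerProd_ne_zero hq
  have h9 := eulerProd_ne_zero (norm_pow_succ_lt_one hq 8)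
  rw [hauptmodul, ← pow_mul, h]
  revert hQ
  generalize 1 + 9 * etaQuot q + 27 * etaQuot q ^ 2 = Q
  intro hQ
  rw [etaQuot]
  field_simp

lemma cubicTheta_pow_three {q : ℂ} (hq : ‖q‖ < 1) :
    (1 + 3 * etaQuot q) ^ 2 * cubicTheta q = (1 + 9 * etaQuot q) ^ 2 * cubicTheta (q ^ 3) := by
  obtain ⟨d₁, h₁, e₁⟩ := hasDerivAt_eulerProd_pow hq 0
  obtain ⟨d₃, h₃, e₃⟩ := hasDerivAt_eulerProd_pow hq 2
  obtain ⟨d₉, h₉, e₉⟩ := hasDerivAt_eulerProd_pow hq 8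
  simp only [zero_add, pow_one] at h₁ e₁
  norm_num only [Nat.cast_ofNat, Nat.cast_zero] at e₁ e₃ e₉ h₃ h₉
  have hL := h₃.pow 12
  have hR := (((h₁.pow 9).mul (h₉.pow 3)).add
    ((((hasDerivAt_id q).const_mul 9).mul (h₁.pow 6)).mul (h₉.pow 6))).add
    (((((hasDerivAt_id q).pow 2).const_mul 27).mul (h₁.pow 3)).mul (h₉.pow 9))
  have heq := hL.unique (hR.congr_of_eventuallyEq (by
    filter_upwards [Metric.isOpen_ball.mem_nhds (show q ∈ Metric.ball (0 : ℂ) 1 by simpa using hq)]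
      with x hx
    simpa using eulerProd_cubic (q := x) (by simpa using hx)))
  simp only [Pi.mul_apply, Pi.pow_apply, id, Nat.cast_ofNat, mul_one] at heq
  have hQ := one_add_etaQuot_ne_zero hq
  have hE := eulerProd_cube_pow_etaQuot hq
  have h0 := eulerProd_ne_zero hq
  have h9 : eulerProd (q ^ 9) ≠ 0 := eulerProd_ne_zero (norm_pow_succ_lt_one hq 8)
  have hh : q * eulerProd (q ^ 9) ^ 3 = etaQuot q * eulerProd q ^ 3 := by
    rw [etaQuot]
    field_simp
  have hlog : -36 * lambertSeries (q ^ 3) * eulerProd (q ^ 3) ^ 12 =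
      eulerProd q ^ 9 * eulerProd (q ^ 9) ^ 3 *
        (-9 * lambertSeries q - 27 * lambertSeries (q ^ 9)) +
      9 * q * eulerProd q ^ 6 * eulerProd (q ^ 9) ^ 6 *
        (1 - 6 * lambertSeries q - 54 * lambertSeries (q ^ 9)) +
      27 * q ^ 2 * eulerProd q ^ 3 * eulerProd (q ^ 9) ^ 9 *
        (2 - 3 * lambertSeries q - 81 * lambertSeries (q ^ 9)) := by
    linear_combination q * heq - 12 * eulerProd (q ^ 3) ^ 11 * e₃ +
      (9 * eulerProd q ^ 8 * eulerProd (q ^ 9) ^ 3 +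
        54 * q * eulerProd q ^ 5 * eulerProd (q ^ 9) ^ 6 +
        81 * q ^ 2 * eulerProd q ^ 2 * eulerProd (q ^ 9) ^ 9) * e₁ +
      (3 * eulerProd q ^ 9 * eulerProd (q ^ 9) ^ 2 +
        54 * q * eulerProd q ^ 6 * eulerProd (q ^ 9) ^ 5 +
        243 * q ^ 2 * eulerProd q ^ 3 * eulerProd (q ^ 9) ^ 8) * e₉
  have key : -36 * lambertSeries (q ^ 3) * (1 + 9 * etaQuot q + 27 * etaQuot q ^ 2) =
      (-9 * lambertSeries q - 27 * lambertSeries (q ^ 9)) +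
      9 * etaQuot q * (1 - 6 * lambertSeries q - 54 * lambertSeries (q ^ 9)) +
      27 * etaQuot q ^ 2 * (2 - 3 * lambertSeries q - 81 * lambertSeries (q ^ 9)) := by
    refine mul_left_cancel₀ (mul_ne_zero (pow_ne_zero 9 h0) (pow_ne_zero 3 h9)) ?_
    linear_combination hlog + 36 * lambertSeries (q ^ 3) * hE +
      9 * eulerProd q ^ 6 * eulerProd (q ^ 9) ^ 3 *
        (1 - 6 * lambertSeries q - 54 * lambertSeries (q ^ 9)) * hh +
      27 * eulerProd q ^ 3 * eulerProd (q ^ 9) ^ 3 *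
        (2 - 3 * lambertSeries q - 81 * lambertSeries (q ^ 9)) *
        (q * eulerProd (q ^ 9) ^ 3 + etaQuot q * eulerProd q ^ 3) * hh
  refine mul_left_cancel₀ hQ ?_
  rw [cubicTheta, cubicTheta, ← pow_mul]
  linear_combination ((1 + 3 * etaQuot q) ^ 2 + (1 + 9 * etaQuot q) ^ 2 / 3) * key

end JacobiCube

section CubicTheta

open Filter Topology

lemma eventually_cube_cpow_two_thirds :
    ∀ᶠ w : ℂ in 𝓝 1, (w ^ 3) ^ ((2 : ℂ) / 3) = w ^ 2 := by
  have hc : Tendsto Complex.arg (𝓝 1) (𝓝 0) := by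
    simpa using (Complex.continuousAt_arg Complex.one_mem_slitPlane).tendsto
  have hpi : 0 < Real.pi / 3 := by positivity
  filter_upwards [hc.eventually (Ioo_mem_nhds (neg_lt_zero.2 hpi) hpi)] with w hw
  rw [← Complex.cpow_nat_mul' (n := 3) (by push_cast; linarith [hw.1])
    (by push_cast; linarith [hw.2])]
  rw [← Complex.cpow_ofNat]
  norm_num

lemma eventually_norm_lt_one : ∀ᶠ q : ℂ in 𝓝 0, ‖q‖ < 1 := by
  filter_upwards [Metric.ball_mem_nhds (0 : ℂ) one_pos] with q hq
  simpa using hq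

lemma continuousAt_eulerProd : ContinuousAt eulerProd 0 :=
  (differentiableOn_eulerProd.differentiableAt
    (Metric.ball_mem_nhds (0 : ℂ) one_pos)).continuousAt

lemma eulerProd_zero : eulerProd 0 = 1 := by simp [eulerProd]

lemma tendsto_eulerProd_pow {k : ℕ} (hk : k ≠ 0) :
    Tendsto (fun q => eulerProd (q ^ k)) (𝓝 0) (𝓝 1) := by
  have h : Tendsto (fun q : ℂ => q ^ k) (𝓝 0) (𝓝 0) := by
    simpa [hk] using (continuous_pow (M := ℂ) k).tendsto 0
  have h2 := continuousAt_eulerProd.tendsto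
  rw [eulerProd_zero] at h2
  exact h2.comp h

lemma tendsto_lambertSeries : Tendsto lambertSeries (𝓝 0) (𝓝 0) := by
  have hd : ContinuousAt (deriv eulerProd) 0 :=
    ((differentiableOn_eulerProd.deriv Metric.isOpen_ball).differentiableAt
      (Metric.ball_mem_nhds (0 : ℂ) one_pos)).continuousAt
  have h : Tendsto (fun q => -(q * deriv eulerProd q / eulerProd q)) (𝓝 0) (𝓝 0) := by
    have := ((continuousAt_id.mul hd).div continuousAt_eulerProd
      (by rw [eulerProd_zero]; exact one_ne_zero)).neg.tendsto
    simpa using! this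
  refine h.congr' ?_
  filter_upwards [eventually_norm_lt_one] with q hq
  rw [mul_deriv_eulerProd hq, neg_mul, neg_div, neg_neg, mul_div_cancel_right₀ _
    (eulerProd_ne_zero hq)]

lemma tendsto_cubicTheta : Tendsto cubicTheta (𝓝 0) (𝓝 1) := by
  have h : Tendsto (fun q : ℂ => q ^ 3) (𝓝 0) (𝓝 0) := by
    simpa using (continuous_pow (M := ℂ) 3).tendsto 0
  simpa using! (((tendsto_lambertSeries.comp h).const_mul 36).const_sub 1).add
    (tendsto_lambertSeries.const_mul 12)

lemma tendsto_etaQuot : Tendsto etaQuot (𝓝 0) (𝓝 0) := by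
  simpa using! ((tendsto_id (x := 𝓝 (0 : ℂ))).mul
    ((tendsto_eulerProd_pow (k := 9) (by norm_num)).pow 3)).div
    ((tendsto_eulerProd_pow one_ne_zero).pow 3) (by simp)

lemma tendsto_hauptmodul : Tendsto hauptmodul (𝓝 0) (𝓝 0) := by
  have h := (((tendsto_id (x := 𝓝 (0 : ℂ))).mul
    ((tendsto_eulerProd_pow three_ne_zero).pow 12)).div
    ((tendsto_eulerProd_pow one_ne_zero).pow 12) (by simp)).const_mul (-27)
  simp only [pow_one, zero_mul, zero_div, mul_zero] at h
  exact h

/-- The hypergeometric expression `(1 - s)^{2/3} ₂F₁(1/3, 1/3; 1; s)²`. -/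
noncomputable def hypTheta (s : ℂ) : ℂ :=
  (1 - s) ^ ((2 : ℂ) / 3) * hyp2F1 (1 / 3) (1 / 3) 1 s ^ 2

lemma tendsto_hypTheta : Tendsto hypTheta (𝓝 0) (𝓝 1) := by
  obtain ⟨F₁, F₂, hF⟩ := hyp2F1_third_ode
  have h1 : ContinuousAt (hyp2F1 (1 / 3) (1 / 3) 1) 0 := (hF 0 (by simp)).1.continuousAt
  have h2 : ContinuousAt (fun s : ℂ => (1 - s) ^ ((2 : ℂ) / 3)) 0 :=
    ContinuousAt.cpow (by fun_prop) continuousAt_const (by simp)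
  have h0 : hypTheta 0 = 1 := by simp [hypTheta, hyp2F1_zero]
  have h3 : Tendsto hypTheta (𝓝 0) (𝓝 (hypTheta 0)) := (h2.mul (h1.pow 2)).tendsto
  rwa [h0] at h3

lemma hypTheta_hauptmodul_pow_three : ∀ᶠ q : ℂ in 𝓝 0,
    (1 + 3 * etaQuot q) ^ 2 * hypTheta (hauptmodul q) =
      (1 + 9 * etaQuot q) ^ 2 * hypTheta (hauptmodul (q ^ 3)) := by
  obtain ⟨r, hr, hcubic⟩ := hyp2F1_cubic
  have h1 : Tendsto (fun h : ℂ => 1 + 9 * h) (𝓝 0) (𝓝 1) := by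
    simpa using Continuous.tendsto (show Continuous fun h : ℂ => 1 + 9 * h by fun_prop) 0
  have h2 : Tendsto (fun h : ℂ => (1 + 3 * h) * (1 + 9 * h + 27 * h ^ 2) ^ (-(1 / 3) : ℂ))
      (𝓝 0) (𝓝 1) := by
    have : ContinuousAt (fun h : ℂ => (1 + 3 * h) * (1 + 9 * h + 27 * h ^ 2) ^ (-(1 / 3) : ℂ)) 0 :=
      ContinuousAt.mul (by fun_prop)
        (ContinuousAt.cpow (by fun_prop) continuousAt_const (by simp))
    simpa using this.tendsto
  filter_upwards [eventually_norm_lt_one,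
    tendsto_etaQuot.eventually (Metric.ball_mem_nhds 0 hr),
    tendsto_etaQuot.eventually (h1.eventually eventually_cube_cpow_two_thirds),
    tendsto_etaQuot.eventually (h2.eventually eventually_cube_cpow_two_thirds)] with q hq hqr e1 e2
  have hQ := one_add_etaQuot_ne_zero hq
  have hF := hcubic (etaQuot q) (by simpa using hqr)
  have hR : ((1 + 9 * etaQuot q + 27 * etaQuot q ^ 2) ^ (-(1 / 3) : ℂ)) ^ 3 =
      (1 + 9 * etaQuot q + 27 * etaQuot q ^ 2)⁻¹ := by
    rw [← Complex.cpow_mul_nat, ← Complex.cpow_neg_one]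
    norm_num
  have s1 : 1 - hauptmodul q = (1 + 9 * etaQuot q) ^ 3 := by
    rw [hauptmodul_eq hq]
    ring
  have s3 : 1 - hauptmodul (q ^ 3) = ((1 + 3 * etaQuot q) *
      (1 + 9 * etaQuot q + 27 * etaQuot q ^ 2) ^ (-(1 / 3) : ℂ)) ^ 3 := by
    rw [hauptmodul_pow_three hq, mul_pow, hR, eq_mul_inv_iff_mul_eq₀ hQ, sub_mul,
      div_mul_cancel₀ _ hQ]
    ring
  rw [hypTheta, hypTheta, s1, s3, e1, e2, hauptmodul_eq hq, hauptmodul_pow_three hq, hF]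
  ring

lemma eq_of_tendsto_of_pow_three {f : ℂ → ℂ} {c : ℂ} {r : ℝ} (hr : r ≤ 1)
    (hf : Tendsto f (𝓝 0) (𝓝 c)) (h : ∀ q, ‖q‖ < r → f q = f (q ^ 3)) {q : ℂ} (hq : ‖q‖ < r) :
    f q = c := by
  have h3 : ∀ n : ℕ, ‖q ^ 3 ^ n‖ < r ∧ f q = f (q ^ 3 ^ n) := by
    intro n
    have hn : ‖q ^ 3 ^ n‖ < r := by
      rw [norm_pow]
      exact (pow_le_of_le_one (norm_nonneg q) (hq.le.trans hr) (by positivity)).trans_lt hq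
    refine ⟨hn, ?_⟩
    induction n with
    | zero => simp
    | succ n ih =>
      have hn' : ‖q ^ 3 ^ n‖ < r := by
        rw [norm_pow]
        exact (pow_le_of_le_one (norm_nonneg q) (hq.le.trans hr) (by positivity)).trans_lt hq
      rw [ih hn', h _ hn', ← pow_mul, ← pow_succ]
  have ht : Tendsto (fun n : ℕ => q ^ 3 ^ n) atTop (𝓝 0) :=
    (tendsto_pow_atTop_nhds_zero_of_norm_lt_one (hq.trans_le hr)).comp
      (tendsto_pow_atTop_atTop_of_one_lt (by norm_num))
  refine tendsto_nhds_unique ?_ (hf.comp ht)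
  exact tendsto_const_nhds.congr fun n => (h3 n).2

lemma cubicTheta_eventuallyEq : ∀ᶠ q : ℂ in 𝓝 0, cubicTheta q = hypTheta (hauptmodul q) := by
  have hH := tendsto_hypTheta.comp tendsto_hauptmodul
  have hlim : Tendsto (fun q => cubicTheta q / hypTheta (hauptmodul q)) (𝓝 0) (𝓝 1) := by
    simpa using! tendsto_cubicTheta.div hH one_ne_zero
  have hpow : Tendsto (fun q : ℂ => q ^ 3) (𝓝 0) (𝓝 0) := by
    simpa using (continuous_pow (M := ℂ) 3).tendsto 0
  have hne := hH.eventually_ne one_ne_zero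
  have hlin : ∀ c : ℂ, ∀ᶠ q in 𝓝 0, 1 + c * etaQuot q ≠ 0 := fun c => by
    have : Tendsto (fun q => 1 + c * etaQuot q) (𝓝 0) (𝓝 1) := by
      simpa using (tendsto_etaQuot.const_mul c).const_add 1
    exact this.eventually_ne one_ne_zero
  obtain ⟨r, hr, hball⟩ := Metric.eventually_nhds_iff_ball.1 (eventually_norm_lt_one.and
    (hne.and ((hpow.eventually hne).and ((hlin 3).and ((hlin 9).and
      hypTheta_hauptmodul_pow_three)))))
  refine Metric.eventually_nhds_iff_ball.2 ⟨min r 1, by positivity, fun q hq => ?_⟩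
  have key := eq_of_tendsto_of_pow_three (min_le_right r 1) hlim (fun q hq => by
    obtain ⟨h1, hn, hn3, l3, l9, hh⟩ := hball q (by simpa using hq.trans_le (min_le_left r 1))
    have hP := cubicTheta_pow_three h1
    simp only [Function.comp_apply] at hn hn3
    rw [div_eq_div_iff hn hn3]
    refine mul_left_cancel₀ (mul_ne_zero (pow_ne_zero 2 l3) (pow_ne_zero 2 l9)) ?_
    linear_combination (1 + 9 * etaQuot q) ^ 2 * hypTheta (hauptmodul (q ^ 3)) * hP -
      (1 + 9 * etaQuot q) ^ 2 * cubicTheta (q ^ 3) * hh) (q := q) (by simpa using hq)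
  have hn := (hball q (Metric.ball_subset_ball (min_le_left r 1) hq)).2.1
  exact (div_eq_one_iff_eq hn).1 key

lemma qpar_three_mul (τ : ℂ) : qpar (3 * τ) = qpar τ ^ 3 := by
  rw [qpar, qpar, ← Complex.exp_nat_mul]
  congr 1
  push_cast
  ring

lemma norm_qpar (τ : ℂ) : ‖qpar τ‖ = Real.exp (-(2 * Real.pi) * τ.im) := by
  rw [qpar, Complex.norm_exp]
  simp

lemma Eis2_eq (τ : ℂ) : Eis2 τ = 1 - 24 * lambertSeries (qpar τ) := rfl

lemma dedekindEta_quotient (τ : ℂ) :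
    -27 * dedekindEta (3 * τ) ^ 12 / dedekindEta τ ^ 12 = hauptmodul (qpar τ) := by
  have h : ∀ σ, dedekindEta σ ^ 12 =
      Complex.exp (Real.pi * Complex.I * σ) * eulerProd (qpar σ) ^ 12 := fun σ => by
    rw [dedekindEta, mul_pow, ← Complex.exp_nat_mul]
    congr 2
    push_cast
    ring
  have h3 : Complex.exp (Real.pi * Complex.I * (3 * τ)) =
      qpar τ * Complex.exp (Real.pi * Complex.I * τ) := by
    rw [qpar, ← Complex.exp_add]
    congr 1
    ring
  rw [h, h, h3, qpar_three_mul, hauptmodul]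
  have := Complex.exp_ne_zero (Real.pi * Complex.I * τ)
  field_simp

end CubicTheta

/- STATEMENT 10: with `s = −27 η(3τ)¹²/η(τ)¹²`,
`(3E₂(3τ) − E₂(τ))/2 = (1−s)^{2/3} ₂F₁(1/3,1/3;1;s)²` for `Im τ` large. -/

theorem stmt10 :
    ∃ Y : ℝ, 0 < Y ∧ ∀ τ : ℂ, Y < τ.im →
      (3 * Eis2 (3 * τ) - Eis2 τ) / 2
        = (1 - (-27 * dedekindEta (3 * τ) ^ 12 / dedekindEta τ ^ 12)) ^ ((2 : ℂ) / 3) *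
          (hyp2F1 (1/3) (1/3) 1 (-27 * dedekindEta (3 * τ) ^ 12 / dedekindEta τ ^ 12)) ^ 2 := by
  obtain ⟨r, hr, h⟩ := Metric.eventually_nhds_iff_ball.1 cubicTheta_eventuallyEq
  refine ⟨max 1 (-Real.log r / (2 * Real.pi)), by positivity, fun τ hτ => ?_⟩
  have hq : ‖qpar τ‖ < r := by
    rw [norm_qpar, ← Real.lt_log_iff_exp_lt hr]
    have h1 := (div_lt_iff₀ (by positivity)).1 ((le_max_right _ _).trans_lt hτ)
    linarith
  rw [dedekindEta_quotient, Eis2_eq, Eis2_eq, qpar_three_mul]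
  refine Eq.trans ?_ (h (qpar τ) (by simpa using hq))
  rw [cubicTheta]
  ring
end

section
/- There exists Y > 0 such that for every τ in the upper half-plane ℍ with Im τ > Y, one has E₄(τ) = ₂F₁(1/12, 5/12; 1; 1728/j(τ))⁴, where j(τ) = 1728·E₄(τ)³/(E₄(τ)³ − E₆(τ)²). -/
/- STATEMENT 12: `E₄(τ) = ₂F₁(1/12,5/12;1;1728/j(τ))⁴` for `Im τ` large,
where `j = 1728 E₄³/(E₄³ − E₆²)`. -/

open Complex

/-- `E₄(τ) = 1 + 240 ∑_{n≥1} n³qⁿ/(1−qⁿ)`. -/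
noncomputable def Eis4 (τ : ℂ) : ℂ :=
  1 + 240 * ∑' n : ℕ, ((n : ℂ) + 1) ^ 3 * qpar τ ^ (n + 1) / (1 - qpar τ ^ (n + 1))

/-- `E₆(τ) = 1 − 504 ∑_{n≥1} n⁵qⁿ/(1−qⁿ)`. -/
noncomputable def Eis6 (τ : ℂ) : ℂ :=
  1 - 504 * ∑' n : ℕ, ((n : ℂ) + 1) ^ 5 * qpar τ ^ (n + 1) / (1 - qpar τ ^ (n + 1))

/-- Elliptic modular function `j = 1728 E₄³/(E₄³ − E₆²)`. -/
noncomputable def jfun (τ : ℂ) : ℂ :=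
  1728 * Eis4 τ ^ 3 / (Eis4 τ ^ 3 - Eis6 τ ^ 2)

open UpperHalfPlane hiding I
open ModularForm EisensteinSeries Derivative Filter Topology ModularGroup
open scoped MatrixGroups Manifold ArithmeticFunction.sigma

lemma tendsto_tsum_sigma_mul_pow (k : ℕ) :
    Tendsto (fun q : ℂ ↦ ∑' n : ℕ+, (σ k n : ℂ) * q ^ (n : ℕ)) (𝓝 0) (𝓝 0) := by
  have hs : Summable fun n : ℕ ↦ (n : ℝ) ^ (k + 1) * (1 / 2 : ℝ) ^ n :=
    summable_pow_mul_geometric_of_norm_lt_one (k + 1) (by norm_num)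
  have hs' : Summable fun n : ℕ+ ↦ ((n : ℕ) : ℝ) ^ (k + 1) * (1 / 2 : ℝ) ^ (n : ℕ) :=
    hs.comp_injective PNat.coe_injective
  have := tendsto_tsum_of_dominated_convergence (𝓕 := 𝓝 (0 : ℂ)) (g := fun _ : ℕ+ ↦ (0 : ℂ))
    (f := fun q (n : ℕ+) ↦ (σ k n : ℂ) * q ^ (n : ℕ)) hs' (fun n ↦ ?_) ?_
  · simpa using this
  · have : ContinuousAt (fun q : ℂ ↦ (σ k n : ℂ) * q ^ (n : ℕ)) 0 := by fun_prop
    simpa [ContinuousAt] using this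
  · filter_upwards [Metric.ball_mem_nhds (0 : ℂ) (by norm_num : (0 : ℝ) < 1 / 2)] with q hq n
    rw [norm_mul, norm_pow, Complex.norm_natCast]
    have : ‖q‖ ≤ 1 / 2 := by simpa using (mem_ball_zero_iff.mp hq).le
    gcongr
    exact_mod_cast ArithmeticFunction.sigma_le_pow_succ k n

lemma tendsto_atImInfty_tsum_sigma (k : ℕ) :
    Tendsto (fun z : ℍ ↦ ∑' n : ℕ+, (σ k n : ℂ) * cexp (2 * Real.pi * I * z) ^ (n : ℕ))
      atImInfty (𝓝 0) := by
  have := (tendsto_tsum_sigma_mul_pow k).comp (qParam_tendsto_atImInfty one_pos)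
  simpa [Function.comp_def, Function.Periodic.qParam] using this

lemma E4_eq_tsum (z : ℍ) :
    E₄ z = 1 + 240 * ∑' n : ℕ+, (σ 3 n : ℂ) * cexp (2 * Real.pi * I * z) ^ (n : ℕ) := by
  rw [E₄, q_expansion_bernoulli _ ⟨2, rfl⟩, show bernoulli 4 = -1 / 30 by decide +kernel]
  norm_num

lemma E6_eq_tsum (z : ℍ) :
    E₆ z = 1 - 504 * ∑' n : ℕ+, (σ 5 n : ℂ) * cexp (2 * Real.pi * I * z) ^ (n : ℕ) := by
  rw [E₆, q_expansion_bernoulli _ ⟨3, rfl⟩, show bernoulli 6 = 1 / 42 by decide +kernel]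
  norm_num

lemma tendsto_E2 : Tendsto E2 atImInfty (𝓝 1) := by
  have := ((tendsto_atImInfty_tsum_sigma 1).const_mul 24).const_sub 1
  refine (by simpa using this : Tendsto _ _ (𝓝 (1 : ℂ))).congr fun z ↦ (E2_eq_tsum_cexp z).symm

lemma tendsto_E4 : Tendsto E₄ atImInfty (𝓝 1) := by
  have := ((tendsto_atImInfty_tsum_sigma 3).const_mul 240).const_add 1
  refine (by simpa using this : Tendsto _ _ (𝓝 (1 : ℂ))).congr fun z ↦ (E4_eq_tsum z).symm

lemma tendsto_E6 : Tendsto E₆ atImInfty (𝓝 1) := by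
  have := ((tendsto_atImInfty_tsum_sigma 5).const_mul 504).const_sub 1
  refine (by simpa using this : Tendsto _ _ (𝓝 (1 : ℂ))).congr fun z ↦ (E6_eq_tsum z).symm

lemma tendsto_normalizedDeriv {F : ℍ → ℂ} (hF : MDiff F) {c : ℂ}
    (hc : Tendsto F atImInfty (𝓝 c)) : Tendsto (D F) atImInfty (𝓝 0) := by
  have h0 : IsZeroAtImInfty (fun z ↦ F z - c) := by
    simpa [IsZeroAtImInfty, ZeroAtFilter] using hc.sub_const c
  suffices Tendsto (fun z : ℍ ↦ deriv (F ∘ ofComplex) z) atImInfty (𝓝 0) by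
    have h := this.const_mul (2 * Real.pi * I)⁻¹
    rwa [mul_zero] at h
  change IsZeroAtImInfty _
  rw [isZeroAtImInfty_iff] at h0 ⊢
  intro ε hε
  obtain ⟨A, hA⟩ := h0 ε hε
  refine ⟨max A 0 + 2, fun z hz ↦ ?_⟩
  have him : ∀ w ∈ Metric.closedBall (z : ℂ) 1, max A 0 < w.im := fun w hw ↦ by
    have h1 := (abs_le.mp ((Complex.abs_im_le_norm (w - z)).trans
      (by simpa [dist_eq_norm] using hw))).1
    rw [Complex.sub_im, UpperHalfPlane.coe_im] at h1
    linarith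
  have hdiff : DifferentiableOn ℂ (fun w ↦ (F ∘ ofComplex) w - c) (Metric.closedBall z 1) :=
    ((UpperHalfPlane.mdifferentiable_iff.mp hF).mono fun w hw ↦
      (le_max_right A 0).trans_lt (him w hw)).sub_const c
  have := Complex.norm_deriv_le_of_forall_mem_sphere_norm_le (c := (z : ℂ)) (C := ε) one_pos
    ((hdiff.mono (by rw [closure_ball _ one_ne_zero])).diffContOnCl) (fun w hw ↦ ?_)
  · simpa [Function.comp_def] using this
  · have hw' := him w (Metric.sphere_subset_closedBall hw)
    have hpos : 0 < w.im := (le_max_right A 0).trans_lt hw'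
    rw [Function.comp_apply, ofComplex_apply_of_im_pos hpos]
    exact hA ⟨w, hpos⟩ ((le_max_left A 0).trans hw'.le)

lemma eq_zero_of_tendsto_zero {k : ℤ} (hk : k < 12) {F : ℍ → ℂ} (hF : MDiff F)
    (hslash : ∀ γ : SL(2, ℤ), F ∣[k] γ = F) (h0 : Tendsto F atImInfty (𝓝 0)) : F = 0 := by
  let f : CuspForm 𝒮ℒ k :=
    { toFun := F
      slash_action_eq' := fun A hA ↦ by
        obtain ⟨A, rfl⟩ := hA
        exact hslash A
      holo' := hF
      zero_at_cusps' := fun hc ↦ by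
        rw [Subgroup.IsArithmetic.isCusp_iff_isCusp_SL2Z] at hc
        rw [OnePoint.isZeroAt_iff_forall_SL2Z hc]
        intro γ _
        rw [hslash]
        exact h0 }
  exact congrArg DFunLike.coe
    (rank_zero_iff_forall_zero.mp (CuspForm.rank_eq_zero_of_weight_lt_twelve hk) f)

lemma slash_E (k : ℕ) (hk : 3 ≤ k) (γ : SL(2, ℤ)) : (E hk : ℍ → ℂ) ∣[(k : ℤ)] γ = E hk :=
  SlashInvariantForm.slash_action_eqn (E hk) _ ⟨γ, rfl⟩

lemma serreDerivative_E4 : serreDerivative 4 E₄ = (-3⁻¹ : ℂ) • (E₆ : ℍ → ℂ) := by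
  have h4 : MDiff (E₄ : ℍ → ℂ) := E₄.holo'
  have h6 : MDiff (E₆ : ℍ → ℂ) := E₆.holo'
  have hS := serreDerivative_mdifferentiable 4 h4
  have key := eq_zero_of_tendsto_zero (k := 6) (by norm_num)
    (F := serreDerivative 4 E₄ - (-3⁻¹ : ℂ) • (E₆ : ℍ → ℂ))
    (hS.sub (h6.const_smul _)) (fun γ ↦ ?_) ?_
  · exact sub_eq_zero.mp key
  · have h1 := serreDerivative_slash_invariant (k := 4) (γ := γ) h4 (slash_E 4 _ γ)
    have h2 := slash_E 6 (by norm_num) γ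
    push_cast at h1 h2
    rw [sub_eq_add_neg, SlashAction.add_slash, SlashAction.neg_slash, SL_smul_slash, h2]
    congr 1
  · have := ((tendsto_normalizedDeriv h4 tendsto_E4).sub
      ((tendsto_E2.const_mul (4 * 12⁻¹)).mul tendsto_E4)).sub (tendsto_E6.const_mul (-3⁻¹))
    norm_num at this
    refine this.congr fun z ↦ ?_
    simp only [Pi.sub_apply, Pi.smul_apply, serreDerivative_apply, smul_eq_mul]
    ring

lemma serreDerivative_E6 : serreDerivative 6 E₆ = (-2⁻¹ : ℂ) • ((E₄ : ℍ → ℂ) * E₄) := by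
  have h4 : MDiff (E₄ : ℍ → ℂ) := E₄.holo'
  have h6 : MDiff (E₆ : ℍ → ℂ) := E₆.holo'
  have hS := serreDerivative_mdifferentiable 6 h6
  have key := eq_zero_of_tendsto_zero (k := 8) (by norm_num)
    (F := serreDerivative 6 E₆ - (-2⁻¹ : ℂ) • ((E₄ : ℍ → ℂ) * E₄))
    (hS.sub ((h4.mul h4).const_smul _)) (fun γ ↦ ?_) ?_
  · exact sub_eq_zero.mp key
  · have h1 := serreDerivative_slash_invariant (k := 6) (γ := γ) h6 (slash_E 6 _ γ)
    have h2 := slash_E 4 (by norm_num) γ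
    have h3 := mul_slash_SL2 4 4 γ E₄ E₄
    push_cast at h1 h2
    norm_num at h3
    rw [sub_eq_add_neg, SlashAction.add_slash, SlashAction.neg_slash, SL_smul_slash, h3, h2]
    congr 1
  · have := ((tendsto_normalizedDeriv h6 tendsto_E6).sub
      ((tendsto_E2.const_mul (6 * 12⁻¹)).mul tendsto_E6)).sub
        ((tendsto_E4.mul tendsto_E4).const_mul (-2⁻¹))
    norm_num at this
    refine this.congr fun z ↦ ?_
    simp only [Pi.sub_apply, Pi.smul_apply, Pi.mul_apply, serreDerivative_apply, smul_eq_mul]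
    ring

lemma hasDerivAt_D2 (γ : SL(2, ℤ)) (z : ℍ) :
    HasDerivAt (D2 γ ∘ ofComplex) (-(2 * Real.pi * I) * (γ 1 0 / denom γ z) ^ 2) z := by
  have h := (hasDerivAt_denom_zpow (γ : GL (Fin 2) ℝ) (-1) z).const_mul (2 * Real.pi * I * γ 1 0)
  have hz := denom_ne_zero γ z
  have hev : D2 γ ∘ ofComplex =ᶠ[𝓝 (z : ℂ)]
      fun w ↦ (2 * Real.pi * I * γ 1 0) * denom (γ : GL (Fin 2) ℝ) w ^ (-1 : ℤ) := by
    filter_upwards [isOpen_upperHalfPlaneSet.mem_nhds z.im_pos] with w hw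
    simp [D2, ofComplex_apply_of_im_pos hw, div_eq_mul_inv]
  refine (h.congr_of_eventuallyEq hev).congr_deriv ?_
  rw [show (-1 - 1 : ℤ) = -2 by norm_num, zpow_neg]
  simp [div_eq_mul_inv]
  ring

lemma D_E2_sub_slash (γ : SL(2, ℤ)) :
    (D E2 - (12⁻¹ : ℂ) • (E2 * E2)) ∣[(4 : ℤ)] γ = D E2 - (12⁻¹ : ℂ) • (E2 * E2) := by
  have h1 := normalizedDerivOfComplex_SL_slash (k := 2) E2_mdifferentiable (γ := γ)
  have h3 := mul_slash_SL2 2 2 γ E2 E2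
  norm_num at h1 h3
  rw [sub_eq_add_neg, SlashAction.add_slash, SlashAction.neg_slash, SL_smul_slash, h3,
    ← sub_eq_add_neg]
  ext z
  have h1z := congrFun h1 z
  have hE2z := congrFun (E2_slash_action γ) z
  have hd : D (E2 ∣[(2 : ℤ)] γ) z = D E2 z - (1 / (2 * riemannZeta 2)) *
      ((2 * Real.pi * I)⁻¹ * (-(2 * Real.pi * I) * (γ 1 0 / denom γ z) ^ 2)) := by
    rw [E2_slash_action, normalizedDerivOfComplex, normalizedDerivOfComplex,
      show (E2 - (1 / (2 * riemannZeta 2)) • D2 γ) ∘ ofComplex =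
        E2 ∘ ofComplex - (1 / (2 * riemannZeta 2)) • (D2 γ ∘ ofComplex) from rfl,
      (((UpperHalfPlane.mdifferentiableAt_iff.mp (E2_mdifferentiable z)).hasDerivAt).sub
        ((hasDerivAt_D2 γ z).const_smul _)).deriv, smul_eq_mul]
    ring
  have hpi : (Real.pi : ℂ) ≠ 0 := by exact_mod_cast Real.pi_ne_zero
  simp only [Pi.sub_apply, Pi.smul_apply, Pi.mul_apply, smul_eq_mul, D2] at h1z hE2z ⊢
  rw [hd] at h1z
  rw [hE2z] at h1z ⊢
  rw [riemannZeta_two] at h1z ⊢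
  simp only [Pi.add_apply, Pi.neg_apply, Pi.smul_apply, Pi.mul_apply, smul_eq_mul,
    mul_div_assoc] at h1z ⊢
  set x : ℂ := (γ 1 0 : ℂ) / denom γ z with hx
  generalize (D E2 ∣[(4 : ℤ)] γ) z = A at h1z ⊢
  generalize D E2 z = B at h1z ⊢
  generalize E2 z = C at h1z ⊢
  field_simp at h1z ⊢
  linear_combination -6 * h1z + 36 * x ^ 2 * I_sq

lemma D_E2_eq : D E2 = (12⁻¹ : ℂ) • (E2 * E2) - (12⁻¹ : ℂ) • (E₄ : ℍ → ℂ) := by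
  have h4 : MDiff (E₄ : ℍ → ℂ) := E₄.holo'
  have hD := normalizedDerivOfComplex_mdifferentiable E2_mdifferentiable
  have key := eq_zero_of_tendsto_zero (k := 4) (by norm_num)
    (F := D E2 - (12⁻¹ : ℂ) • (E2 * E2) + (12⁻¹ : ℂ) • (E₄ : ℍ → ℂ))
    ((hD.sub ((E2_mdifferentiable.mul E2_mdifferentiable).const_smul _)).add (h4.const_smul _))
    (fun γ ↦ ?_) ?_
  · rw [← sub_eq_zero, ← key]
    abel
  · rw [SlashAction.add_slash, D_E2_sub_slash, SL_smul_slash]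
    congr 2
    exact slash_E 4 (by norm_num) γ
  · have := ((tendsto_normalizedDeriv E2_mdifferentiable tendsto_E2).sub
      ((tendsto_E2.mul tendsto_E2).const_mul 12⁻¹)).add (tendsto_E4.const_mul 12⁻¹)
    norm_num at this
    refine this.congr fun z ↦ ?_
    simp

lemma hasDerivAt_comp_ofComplex {F : ℍ → ℂ} (hF : MDiff F) {τ : ℂ} (hτ : 0 < τ.im) :
    HasDerivAt (F ∘ ofComplex) (2 * Real.pi * I * D F (ofComplex τ)) τ := by
  have h := (UpperHalfPlane.mdifferentiableAt_iff.mp (hF (ofComplex τ))).hasDerivAt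
  rw [ofComplex_apply_of_im_pos hτ] at h ⊢
  refine h.congr_deriv ?_
  rw [normalizedDerivOfComplex, mul_inv_cancel_left₀ two_pi_I_ne_zero]

lemma hasDerivAt_E2 {τ : ℂ} (hτ : 0 < τ.im) :
    HasDerivAt (E2 ∘ ofComplex) (2 * Real.pi * I *
      (((E2 ∘ ofComplex) τ ^ 2 - (E₄ ∘ ofComplex) τ) / 12)) τ := by
  refine (hasDerivAt_comp_ofComplex E2_mdifferentiable hτ).congr_deriv ?_
  rw [D_E2_eq]
  simp only [Pi.sub_apply, Pi.smul_apply, Pi.mul_apply, smul_eq_mul, Function.comp_apply]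
  ring

lemma hasDerivAt_E4 {τ : ℂ} (hτ : 0 < τ.im) :
    HasDerivAt (E₄ ∘ ofComplex) (2 * Real.pi * I *
      (((E2 ∘ ofComplex) τ * (E₄ ∘ ofComplex) τ - (E₆ ∘ ofComplex) τ) / 3)) τ := by
  refine (hasDerivAt_comp_ofComplex E₄.holo' hτ).congr_deriv ?_
  have h := congrFun serreDerivative_E4 (ofComplex τ)
  simp only [serreDerivative_apply, Pi.smul_apply, smul_eq_mul] at h
  simp only [Function.comp_apply]
  change _ * D (E₄ : ℍ → ℂ) _ = _
  linear_combination (2 * Real.pi * I) * h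

lemma hasDerivAt_E6 {τ : ℂ} (hτ : 0 < τ.im) :
    HasDerivAt (E₆ ∘ ofComplex) (2 * Real.pi * I *
      (((E2 ∘ ofComplex) τ * (E₆ ∘ ofComplex) τ - (E₄ ∘ ofComplex) τ ^ 2) / 2)) τ := by
  refine (hasDerivAt_comp_ofComplex E₆.holo' hτ).congr_deriv ?_
  have h := congrFun serreDerivative_E6 (ofComplex τ)
  simp only [serreDerivative_apply, Pi.smul_apply, Pi.mul_apply, smul_eq_mul] at h
  simp only [Function.comp_apply]
  change _ * D (E₆ : ℍ → ℂ) _ = _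
  linear_combination (2 * Real.pi * I) * h

/-- The coefficients of `₂F₁(1/12, 5/12; 1; z)`. -/
noncomputable def hypCoeff (n : ℕ) : ℂ :=
  ((ascPochhammer ℂ n).eval (1 / 12) * (ascPochhammer ℂ n).eval (5 / 12)) /
    ((ascPochhammer ℂ n).eval 1 * (n.factorial : ℂ))

/-- The result of applying the Euler operator `z * d/dz` to `₂F₁(1/12, 5/12; 1; z)` `k` times. -/
noncomputable def hypEuler (k : ℕ) (z : ℂ) : ℂ :=
  ∑' n : ℕ, (n : ℂ) ^ k * hypCoeff n * z ^ n

lemma hypCoeff_zero : hypCoeff 0 = 1 := by simp [hypCoeff]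

lemma hypCoeff_succ (n : ℕ) :
    hypCoeff (n + 1) = hypCoeff n * ((1 / 12 + n) * (5 / 12 + n) / ((n : ℂ) + 1) ^ 2) := by
  have h1 : (n.factorial : ℂ) ≠ 0 := by exact_mod_cast n.factorial_ne_zero
  have h2 : (n : ℂ) + 1 ≠ 0 := by exact_mod_cast n.succ_ne_zero
  simp only [hypCoeff, ascPochhammer_succ_eval, ascPochhammer_eval_one, Nat.factorial_succ]
  push_cast
  rw [add_comm (1 : ℂ) n]
  field_simp

lemma norm_hypCoeff_le_one (n : ℕ) : ‖hypCoeff n‖ ≤ 1 := by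
  induction n with
  | zero => simp [hypCoeff_zero]
  | succ n ih =>
    rw [hypCoeff_succ, norm_mul]
    refine mul_le_one₀ ih (norm_nonneg _) ?_
    have h : ((1 / 12 + n) * (5 / 12 + n) / ((n : ℂ) + 1) ^ 2) =
        (((1 / 12 + n) * (5 / 12 + n) / ((n : ℝ) + 1) ^ 2 : ℝ) : ℂ) := by
      push_cast
      ring
    rw [h, Complex.norm_real, Real.norm_of_nonneg (by positivity), div_le_one (by positivity)]
    nlinarith [(Nat.cast_nonneg n : (0 : ℝ) ≤ n)]

lemma norm_hypEuler_term_le (k n : ℕ) {z : ℂ} {r : ℝ} (hz : ‖z‖ ≤ r) :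
    ‖(n : ℂ) ^ k * hypCoeff n * z ^ n‖ ≤ (n : ℝ) ^ k * r ^ n := by
  rw [norm_mul, norm_mul, norm_pow, norm_pow, Complex.norm_natCast]
  gcongr
  exact mul_le_of_le_one_right (by positivity) (norm_hypCoeff_le_one n)

lemma summable_hypEuler (k : ℕ) {z : ℂ} (hz : ‖z‖ < 1) :
    Summable fun n : ℕ ↦ (n : ℂ) ^ k * hypCoeff n * z ^ n :=
  .of_norm_bounded (summable_pow_mul_geometric_of_norm_lt_one k (by simpa using hz))
    fun n ↦ norm_hypEuler_term_le k n le_rfl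

lemma exists_hasDerivAt_hypEuler (k : ℕ) {z : ℂ} (hz : ‖z‖ < 1) :
    ∃ d, HasDerivAt (hypEuler k) d z ∧ d * z = hypEuler (k + 1) z := by
  obtain ⟨r, hzr, hr⟩ := exists_between hz
  have hr0 : 0 ≤ r := (norm_nonneg z).trans hzr.le
  have hu : Summable fun n : ℕ ↦ (n : ℝ) ^ k * r ^ n :=
    summable_pow_mul_geometric_of_norm_lt_one k (by rwa [Real.norm_of_nonneg hr0])
  have hdiff (n : ℕ) :
      DifferentiableOn ℂ (fun z : ℂ ↦ (n : ℂ) ^ k * hypCoeff n * z ^ n) (Metric.ball 0 r) := by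
    fun_prop
  have hle (n : ℕ) (w : ℂ) (hw : w ∈ Metric.ball (0 : ℂ) r) :=
    norm_hypEuler_term_le k n (mem_ball_zero_iff.mp hw).le
  have hzb : z ∈ Metric.ball (0 : ℂ) r := mem_ball_zero_iff.mpr hzr
  refine ⟨deriv (hypEuler k) z, ((differentiableOn_tsum_of_summable_norm hu hdiff
    Metric.isOpen_ball hle).differentiableAt (Metric.isOpen_ball.mem_nhds hzb)).hasDerivAt, ?_⟩
  refine ((hasSum_deriv_of_summable_norm hu hdiff Metric.isOpen_ball hle hzb).mul_right
    z).unique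
      (((summable_hypEuler (k + 1) hz).hasSum).congr_fun fun n ↦ ?_)
  rw [deriv_const_mul_field, deriv_pow_field]
  rcases n with _ | n
  · simp
  · rw [Nat.add_sub_cancel]
    ring

lemma hypEuler_two {z : ℂ} (hz : ‖z‖ < 1) :
    hypEuler 2 z = z * (hypEuler 2 z + hypEuler 1 z / 2 + 5 / 144 * hypEuler 0 z) := by
  have h2 := summable_hypEuler 2 hz
  have hs := (h2.hasSum.add ((summable_hypEuler 1 hz).hasSum.div_const 2)).add
    ((summable_hypEuler 0 hz).hasSum.mul_left (5 / 144))
  have hshift := (hasSum_nat_add_iff' 1).mpr h2.hasSum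
  rw [Finset.sum_range_one, Nat.cast_zero, zero_pow two_ne_zero, zero_mul, zero_mul,
    sub_zero] at hshift
  refine hshift.unique ((hs.mul_left z).congr_fun fun n ↦ ?_)
  have h : (n : ℂ) + 1 ≠ 0 := by exact_mod_cast n.succ_ne_zero
  rw [hypCoeff_succ]
  push_cast
  field_simp
  ring

lemma tendsto_hypEuler_zero : Tendsto (hypEuler 0) (𝓝 0) (𝓝 1) := by
  obtain ⟨d, hd, -⟩ := exists_hasDerivAt_hypEuler 0 (z := 0) (by simp)
  have h : hypEuler 0 0 = 1 := by
    rw [hypEuler, tsum_eq_single 0 fun n hn ↦ by simp [hn]]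
    simp [hypCoeff_zero]
  simpa [ContinuousAt, h] using hd.continuousAt

lemma tendsto_hypEuler_one : Tendsto (hypEuler 1) (𝓝 0) (𝓝 0) := by
  obtain ⟨d, hd, -⟩ := exists_hasDerivAt_hypEuler 1 (z := 0) (by simp)
  have h : hypEuler 1 0 = 0 := by
    rw [hypEuler, tsum_eq_single 0 fun n hn ↦ by simp [hn]]
    simp
  simpa [ContinuousAt, h] using hd.continuousAt

lemma eq_of_hasDerivAt_zero_of_tendsto {f : ℂ → ℂ} {c : ℂ} {Y : ℝ}
    (hf : ∀ τ : ℂ, Y < τ.im → HasDerivAt f 0 τ)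
    (hc : Tendsto f (comap Complex.im atTop) (𝓝 c)) {τ : ℂ} (hτ : Y < τ.im) : f τ = c := by
  have hopen : IsOpen {w : ℂ | Y < w.im} := isOpen_lt continuous_const Complex.continuous_im
  have hconst : ∀ w : ℂ, Y < w.im → f w = f τ := fun w hw ↦
    hopen.is_const_of_deriv_eq_zero (convex_halfSpace_im_gt Y).isPreconnected
      (fun x hx ↦ (hf x hx).differentiableAt.differentiableWithinAt)
      (fun x hx ↦ (hf x hx).deriv) hw hτ
  have hne : (comap Complex.im atTop).NeBot :=
    comap_neBot_iff_frequently.mpr (.of_forall fun y ↦ ⟨y * I, by simp⟩)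
  refine tendsto_nhds_unique (tendsto_const_nhds.congr' ?_) hc
  filter_upwards [preimage_mem_comap (Ioi_mem_atTop Y)] with w hw
  exact (hconst w hw).symm

/-- Functions satisfying Ramanujan's differential equations and tending to `1` at `i∞` satisfy
Fricke's identity. -/
lemma hypEuler_zero_pow_four_of_ramanujan {P Q R : ℂ → ℂ} {Y : ℝ}
    (hP : ∀ τ : ℂ, Y < τ.im →
      HasDerivAt P (2 * Real.pi * I * ((P τ ^ 2 - Q τ) / 12)) τ)
    (hQ : ∀ τ : ℂ, Y < τ.im →
      HasDerivAt Q (2 * Real.pi * I * ((P τ * Q τ - R τ) / 3)) τ)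
    (hR : ∀ τ : ℂ, Y < τ.im →
      HasDerivAt R (2 * Real.pi * I * ((P τ * R τ - Q τ ^ 2) / 2)) τ)
    (hP1 : Tendsto P (comap Complex.im atTop) (𝓝 1))
    (hQ1 : Tendsto Q (comap Complex.im atTop) (𝓝 1))
    (hR1 : Tendsto R (comap Complex.im atTop) (𝓝 1))
    (hQ0 : ∀ τ : ℂ, Y < τ.im → Q τ ≠ 0)
    (ht : ∀ τ : ℂ, Y < τ.im → ‖1 - R τ ^ 2 / Q τ ^ 3‖ < 1) {τ : ℂ} (hτ : Y < τ.im) :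
    hypEuler 0 (1 - R τ ^ 2 / Q τ ^ 3) ^ 4 = Q τ := by
  set t : ℂ → ℂ := fun τ ↦ 1 - R τ ^ 2 / Q τ ^ 3 with ht_def
  have hdt (τ : ℂ) (hτ : Y < τ.im) :
      HasDerivAt t (2 * Real.pi * I * (t τ * (R τ / Q τ))) τ := by
    have hq := hQ0 τ hτ
    refine ((((hR τ hτ).pow 2).div ((hQ τ hτ).pow 3) (pow_ne_zero 3 hq)).const_sub
      1).congr_deriv ?_
    simp only [ht_def, Pi.pow_apply]
    field_simp
    ring
  have hdH (k : ℕ) (τ : ℂ) (hτ : Y < τ.im) : HasDerivAt (fun τ ↦ hypEuler k (t τ))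
      (2 * Real.pi * I * (hypEuler (k + 1) (t τ) * (R τ / Q τ))) τ := by
    obtain ⟨d, hd, hdz⟩ := exists_hasDerivAt_hypEuler k (ht τ hτ)
    refine (hd.comp τ (hdt τ hτ)).congr_deriv ?_
    rw [← hdz]
    ring
  have htlim : Tendsto t (comap Complex.im atTop) (𝓝 0) := by
    simpa using ((hR1.pow 2).div (hQ1.pow 3) (by simp)).const_sub 1
  obtain ⟨G, hG⟩ : ∃ G : ℂ → ℂ, G = hypEuler 0 ∘ t := ⟨_, rfl⟩
  obtain ⟨K, hK⟩ : ∃ K : ℂ → ℂ, K = hypEuler 1 ∘ t := ⟨_, rfl⟩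
  obtain ⟨L, hL⟩ : ∃ L : ℂ → ℂ, L = hypEuler 2 ∘ t := ⟨_, rfl⟩
  have hGlim : Tendsto G (comap Complex.im atTop) (𝓝 1) := hG ▸ tendsto_hypEuler_zero.comp htlim
  have hKlim : Tendsto K (comap Complex.im atTop) (𝓝 0) := hK ▸ tendsto_hypEuler_one.comp htlim
  have hdG (τ : ℂ) (hτ : Y < τ.im) :
      HasDerivAt G (2 * Real.pi * I * (K τ * (R τ / Q τ))) τ := hG ▸ hK ▸ hdH 0 τ hτ
  have hdK (τ : ℂ) (hτ : Y < τ.im) :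
      HasDerivAt K (2 * Real.pi * I * (L τ * (R τ / Q τ))) τ := hK ▸ hL ▸ hdH 1 τ hτ
  have hode (τ : ℂ) (hτ : Y < τ.im) :
      R τ ^ 2 * L τ = (Q τ ^ 3 - R τ ^ 2) * (K τ / 2 + 5 / 144 * G τ) := by
    have hq := hQ0 τ hτ
    have h : L τ = t τ * (L τ + K τ / 2 + 5 / 144 * G τ) := by
      simpa [hG, hK, hL] using hypEuler_two (ht τ hτ)
    have htτ : Q τ ^ 3 * t τ = Q τ ^ 3 - R τ ^ 2 := by
      simp only [ht_def]
      field_simp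
    linear_combination Q τ ^ 3 * h + (L τ + K τ / 2 + 5 / 144 * G τ) * htτ
  change (hypEuler 0 ∘ t) τ ^ 4 = Q τ
  rw [← hG]
  set X : ℂ → ℂ := fun τ ↦ K τ * R τ - G τ * (P τ * Q τ - R τ) / 12 with hX_def
  have hdX (τ : ℂ) (hτ : Y < τ.im) :
      HasDerivAt X (2 * Real.pi * I * (5 / 12 * (P τ - R τ / Q τ) * X τ)) τ := by
    have hq := hQ0 τ hτ
    refine (((hdK τ hτ).mul (hR τ hτ)).sub (((hdG τ hτ).mul
      (((hP τ hτ).mul (hQ τ hτ)).sub (hR τ hτ))).div_const 12)).congr_deriv ?_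
    simp only [hX_def, Pi.mul_apply, Pi.sub_apply]
    field_simp
    linear_combination 864 * hode τ hτ
  have hX0 (τ : ℂ) (hτ : Y < τ.im) : X τ = 0 := by
    have hXlim : Tendsto X (comap Complex.im atTop) (𝓝 0) := by
      simpa using (hKlim.mul hR1).sub ((hGlim.mul ((hP1.mul hQ1).sub hR1)).div_const 12)
    have hlim : Tendsto (fun τ ↦ X τ ^ 4 / Q τ ^ 5) (comap Complex.im atTop) (𝓝 0) := by
      simpa using! (hXlim.pow 4).div (hQ1.pow 5) (by simp)
    have h := eq_of_hasDerivAt_zero_of_tendsto (fun τ hτ ↦ ?_) hlim hτ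
    · simpa [hQ0 τ hτ] using h
    · have hq := hQ0 τ hτ
      refine (((hdX τ hτ).pow 4).div ((hQ τ hτ).pow 5) (pow_ne_zero 5 hq)).congr_deriv ?_
      simp only [Pi.pow_apply]
      field_simp
      ring
  have hlim : Tendsto (fun τ ↦ G τ ^ 4 / Q τ) (comap Complex.im atTop) (𝓝 1) := by
    simpa using! (hGlim.pow 4).div hQ1 one_ne_zero
  have h := eq_of_hasDerivAt_zero_of_tendsto (fun τ hτ ↦ ?_) hlim hτ
  · exact (div_eq_one_iff_eq (hQ0 τ hτ)).mp h
  · have hq := hQ0 τ hτ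
    have hx : K τ * R τ = G τ * (P τ * Q τ - R τ) / 12 := sub_eq_zero.mp (hX0 τ hτ)
    refine (((hdG τ hτ).pow 4).div (hQ τ hτ) hq).congr_deriv ?_
    simp only [Pi.pow_apply]
    field_simp
    linear_combination 24 * Real.pi * I * G τ ^ 3 * hx

lemma tsum_lambert_eq_tsum_sigma (k : ℕ) {q : ℂ} (hq : ‖q‖ < 1) :
    ∑' n : ℕ, ((n : ℂ) + 1) ^ k * q ^ (n + 1) / (1 - q ^ (n + 1)) =
      ∑' n : ℕ+, (σ k n : ℂ) * q ^ (n : ℕ) := by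
  rw [← tsum_pow_div_one_sub_eq_tsum_sigma hq,
    tsum_pnat_eq_tsum_succ (f := fun n : ℕ ↦ (n : ℂ) ^ k * q ^ n / (1 - q ^ n))]
  push_cast
  rfl

lemma Eis4_eq (z : ℍ) : Eis4 z = E₄ z := by
  rw [Eis4, E4_eq_tsum, ← tsum_lambert_eq_tsum_sigma 3 (norm_exp_two_pi_I_lt_one z), qpar]

lemma Eis6_eq (z : ℍ) : Eis6 z = E₆ z := by
  rw [Eis6, E6_eq_tsum, ← tsum_lambert_eq_tsum_sigma 5 (norm_exp_two_pi_I_lt_one z), qpar]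

lemma hyp2F1_eq_hypEuler (z : ℂ) : hyp2F1 (1 / 12) (5 / 12) 1 z = hypEuler 0 z := by
  simp [hyp2F1, hypEuler, hypCoeff]

lemma div_jfun {τ : ℂ} (h : Eis4 τ ≠ 0) :
    1728 / jfun τ = 1 - Eis6 τ ^ 2 / Eis4 τ ^ 3 := by
  rw [jfun, div_div_eq_mul_div, mul_div_mul_left _ _ (by norm_num), sub_div,
    div_self (pow_ne_zero 3 h)]

theorem stmt12 :
    ∃ Y : ℝ, 0 < Y ∧ ∀ τ : ℂ, Y < τ.im →
      Eis4 τ = (hyp2F1 (1/12) (5/12) 1 (1728 / jfun τ)) ^ 4 := by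
  have hP := tendsto_E2.comp tendsto_comap_im_ofComplex
  have hQ := tendsto_E4.comp tendsto_comap_im_ofComplex
  have hR := tendsto_E6.comp tendsto_comap_im_ofComplex
  have ht : Tendsto (fun τ ↦ ‖1 - (E₆ ∘ ofComplex) τ ^ 2 / (E₄ ∘ ofComplex) τ ^ 3‖)
      (comap Complex.im atTop) (𝓝 0) := by
    simpa using! (((hR.pow 2).div (hQ.pow 3) (by simp)).const_sub 1).norm
  have hev := (hQ.eventually_ne one_ne_zero).and (ht.eventually_lt_const one_pos)
  obtain ⟨A, hA⟩ := eventually_atTop.mp (eventually_comap.mp hev)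
  refine ⟨max A 1, by positivity, fun τ hτ ↦ ?_⟩
  have hpos {w : ℂ} (hw : max A 1 < w.im) : 0 < w.im :=
    one_pos.trans ((le_max_right A 1).trans_lt hw)
  have hA' {w : ℂ} (hw : max A 1 < w.im) := hA w.im ((le_max_left A 1).trans hw.le) w rfl
  have key := hypEuler_zero_pow_four_of_ramanujan (fun w hw ↦ hasDerivAt_E2 (hpos hw))
    (fun w hw ↦ hasDerivAt_E4 (hpos hw)) (fun w hw ↦ hasDerivAt_E6 (hpos hw)) hP hQ hR
    (fun w hw ↦ (hA' hw).1) (fun w hw ↦ (hA' hw).2) hτ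
  have h4 : Eis4 τ = (E₄ ∘ ofComplex) τ := by
    simpa [ofComplex_apply_of_im_pos (hpos hτ)] using Eis4_eq ⟨τ, hpos hτ⟩
  have h6 : Eis6 τ = (E₆ ∘ ofComplex) τ := by
    simpa [ofComplex_apply_of_im_pos (hpos hτ)] using Eis6_eq ⟨τ, hpos hτ⟩
  rw [div_jfun (h4 ▸ (hA' hτ).1), hyp2F1_eq_hypEuler, h4, h6, key]
end
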